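/- arXiv:1501.06086 — 7 statements merged into one kernel-verified Lean document; each statement's English description precedes it below -/
import Mathlib

section
/- For every natural number n, in the polynomial ring R = MvPolynomial ℕ ℚ with variables X_0, X_1, X_2, …, and D the unique derivation on R with D(X_i) = X_{i+1}, one has (D + X_1)^n (1) = Σ_{π ∈ Π_n} ∏_{β ∈ π} X_{|β|}, where the sum is over all set partitions π of [n] = {1,…,n} and |β| denotes the size of the block β. (In other words, the coefficient of the monomial X_1^{k_1}⋯X_r^{k_r} in the n-th full exponential Bell polynomial Y_n = (D + X_1)^n(1) equals the number of set partitions of an n-element set into k_1 blocks of size 1, …, k_r blocks of size r.) -/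
open Finset MvPolynomial

section Aux

variable {α : Type*} [DecidableEq α]

/-- Add the new point `a` to an existing block `β`, or as a singleton block (`β = ∅`). -/
def addParts (a : α) (P : Finset (Finset α)) (β : Finset α) : Finset (Finset α) :=
  insert (insert a β) (P.erase β)

/-- Insert `a` in the block `β` of `P`; `β = ∅` means that `{a}` becomes a new block. -/
def addPoint {a : α} {s : Finset α} (ha : a ∉ s) (P : Finpartition s)
    (β : Finset α) (hβ : β ∈ insert ∅ P.parts) : Finpartition (insert a s) :=
  Finpartition.ofExistsUnique (addParts a P.parts β)
    (by
      intro p hp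
      simp only [addParts, mem_insert, mem_erase] at hp
      rcases hp with rfl | ⟨_, hp⟩
      · apply insert_subset_insert
        rcases mem_insert.1 hβ with rfl | h
        · simp
        · exact P.subset h
      · exact (P.subset hp).trans (subset_insert _ _))
    (by
      intro x hx
      have hβa : ∀ p ∈ P.parts, a ∉ p := fun p hp h => ha (P.subset hp h)
      rcases mem_insert.1 hx with rfl | hx
      · refine ⟨insert x β, ?_, ?_⟩
        · simp [addParts]
        · rintro y ⟨hy, hxy⟩
          simp only [addParts, mem_insert, mem_erase] at hy
          rcases hy with rfl | ⟨_, hy⟩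
          · rfl
          · exact absurd hxy (hβa _ hy)
      · have hxa : x ≠ a := fun h => ha (h ▸ hx)
        obtain ⟨t, ht, hxt⟩ := P.exists_mem hx
        have hu : ∀ y ∈ P.parts, x ∈ y → y = t := fun y hy hxy =>
          P.eq_of_mem_parts hy ht hxy hxt
        by_cases htβ : t = β
        · subst htβ
          refine ⟨insert a t, ?_, ?_⟩
          · simp [addParts, hxt]
          · rintro y ⟨hy, hxy⟩
            simp only [addParts, mem_insert, mem_erase] at hy
            rcases hy with rfl | ⟨h1, hy⟩
            · rfl
            · exact absurd (hu _ hy hxy) h1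
        · refine ⟨t, ?_, ?_⟩
          · simp [addParts, hxt, ht, htβ]
          · rintro y ⟨hy, hxy⟩
            simp only [addParts, mem_insert, mem_erase] at hy
            rcases hy with rfl | ⟨h1, hy⟩
            · have hxβ : x ∈ β := by simpa [hxa] using hxy
              rcases mem_insert.1 hβ with rfl | h
              · simp at hxβ
              · exact absurd (hu _ h hxβ).symm htβ
            · exact hu _ hy hxy)
    (by
      simp only [addParts, mem_insert, mem_erase, not_or]
      refine ⟨fun h => ?_, fun h => P.empty_notMem_parts h.2⟩
      exact (insert_ne_empty a β) h.symm)

theorem addPoint_parts {a : α} {s : Finset α} (ha : a ∉ s) (P : Finpartition s)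
    (β : Finset α) (hβ : β ∈ insert ∅ P.parts) :
    (addPoint ha P β hβ).parts = insert (insert a β) (P.parts.erase β) := rfl

/-- Remove the point `a`. -/
def removePoint {a : α} {s : Finset α} (ha : a ∉ s) (Q : Finpartition (insert a s)) :
    Finpartition s :=
  (Q.avoid {a}).copy (by simp [sdiff_singleton_eq_erase, ha])

theorem mem_removePoint {a : α} {s : Finset α} (ha : a ∉ s) (Q : Finpartition (insert a s))
    (c : Finset α) :
    c ∈ (removePoint ha Q).parts ↔ ∃ d ∈ Q.parts, ¬ d ⊆ {a} ∧ d.erase a = c := by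
  have : (removePoint ha Q).parts = (Q.avoid {a}).parts := rfl
  rw [this, Finpartition.mem_avoid]
  simp [sdiff_singleton_eq_erase]

theorem part_addPoint {a : α} {s : Finset α} (ha : a ∉ s) (P : Finpartition s)
    (β : Finset α) (hβ : β ∈ insert ∅ P.parts) :
    ((addPoint ha P β hβ).part a).erase a = β := by
  have haβ : a ∉ β := by
    rcases mem_insert.1 hβ with rfl | h
    · simp
    · exact fun h' => ha (P.subset h h')
  rw [(addPoint ha P β hβ).part_eq_of_mem (t := insert a β) (by simp [addPoint_parts]) (by simp)]
  exact erase_insert haβ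

theorem removePoint_addPoint {a : α} {s : Finset α} (ha : a ∉ s) (P : Finpartition s)
    (β : Finset α) (hβ : β ∈ insert ∅ P.parts) :
    removePoint ha (addPoint ha P β hβ) = P := by
  have hn : ∀ p ∈ P.parts, a ∉ p := fun p hp h => ha (P.subset hp h)
  have hne : ∀ p ∈ P.parts, ¬ p ⊆ {a} := by
    intro p hp h
    obtain ⟨x, hx⟩ := P.nonempty_of_mem_parts hp
    have := mem_singleton.1 (h hx)
    exact hn p hp (this ▸ hx)
  apply Finpartition.ext
  ext c
  rw [mem_removePoint, addPoint_parts]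
  constructor
  · rintro ⟨d, hd, h1, rfl⟩
    simp only [mem_insert, mem_erase] at hd
    rcases hd with rfl | ⟨_, hd⟩
    · rcases mem_insert.1 hβ with rfl | h
      · simp at h1
      · rwa [erase_insert (hn _ h)]
    · rwa [erase_eq_of_notMem (hn _ hd)]
  · intro hc
    by_cases h : c = β
    · subst h
      refine ⟨insert a c, by simp, fun h => hne c hc ((subset_insert _ _).trans h),
        erase_insert (hn _ hc)⟩
    · exact ⟨c, by simp [h, hc], hne c hc, erase_eq_of_notMem (hn _ hc)⟩

theorem part_erase_mem {a : α} {s : Finset α} (ha : a ∉ s) (Q : Finpartition (insert a s)) :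
    (Q.part a).erase a ∈ insert ∅ (removePoint ha Q).parts := by
  rw [mem_insert, mem_removePoint]
  by_cases h : Q.part a ⊆ {a}
  · left
    rw [erase_eq_empty_iff]
    exact subset_singleton_iff.1 h
  · right
    exact ⟨_, Q.part_mem.2 (mem_insert_self _ _), h, rfl⟩

theorem addPoint_removePoint {a : α} {s : Finset α} (ha : a ∉ s) (Q : Finpartition (insert a s)) :
    addPoint ha (removePoint ha Q) ((Q.part a).erase a) (part_erase_mem ha Q) = Q := by
  have hm : a ∈ Q.part a := Q.mem_part_self.2 (mem_insert_self _ _)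
  have hp : Q.part a ∈ Q.parts := Q.part_mem.2 (mem_insert_self _ _)
  have key : ∀ d ∈ Q.parts, d ≠ Q.part a → a ∉ d := fun d hd h h' =>
    h (Q.part_eq_of_mem hd h').symm
  apply Finpartition.ext
  ext c
  rw [addPoint_parts, insert_erase hm, mem_insert, mem_erase, mem_removePoint]
  constructor
  · rintro (rfl | ⟨h1, d, hd, h2, rfl⟩)
    · exact hp
    · have : d ≠ Q.part a := fun h => h1 (by rw [h])
      rwa [erase_eq_of_notMem (key d hd this)]
  · intro hc
    by_cases h : c = Q.part a
    · exact Or.inl h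
    · have hac := key c hc h
      obtain ⟨x, hx⟩ := Q.nonempty_of_mem_parts hc
      have hxa : x ≠ a := fun h => hac (h ▸ hx)
      refine Or.inr ⟨fun h' => h ?_, c, hc, fun h' => hxa (mem_singleton.1 (h' hx)),
        erase_eq_of_notMem hac⟩
      have : x ∈ Q.part a := by
        rw [h'] at hx
        exact mem_of_mem_erase hx
      exact Q.eq_of_mem_parts hc hp hx this

theorem sum_insert_partition {M : Type*} [AddCommMonoid M] {a : α} {s : Finset α} (ha : a ∉ s)
    (f : Finset (Finset α) → M) :
    ∑ Q : Finpartition (insert a s), f Q.parts =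
      ∑ P : Finpartition s, ∑ β ∈ insert ∅ P.parts,
        f (insert (insert a β) (P.parts.erase β)) := by
  rw [Finset.sum_sigma']
  symm
  refine Finset.sum_bij'
    (fun x hx => addPoint ha x.1 x.2 (mem_sigma.1 hx).2)
    (fun Q _ => ⟨removePoint ha Q, (Q.part a).erase a⟩) ?_ ?_ ?_ ?_ ?_
  · intros; simp
  · intro Q _; exact mem_sigma.2 ⟨mem_univ _, part_erase_mem ha Q⟩
  · rintro ⟨P, β⟩ hx
    simp only [removePoint_addPoint, part_addPoint]
  · intro Q _
    exact addPoint_removePoint ha Q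
  · intros; rfl

theorem derivation_prod_aux {ι : Type*} [DecidableEq ι]
    (D : Derivation ℚ (MvPolynomial ℕ ℚ) (MvPolynomial ℕ ℚ))
    (s : Finset ι) (f : ι → MvPolynomial ℕ ℚ) :
    D (∏ i ∈ s, f i) = ∑ i ∈ s, (∏ j ∈ s.erase i, f j) • D (f i) := by
  induction s using Finset.induction_on with
  | empty => simp
  | insert a s ha ih =>
    rw [prod_insert ha, Derivation.leibniz, ih, sum_insert ha, erase_insert ha, add_comm, smul_sum]
    congr 1
    refine sum_congr rfl fun i hi => ?_
    have hai : a ≠ i := fun h => ha (h ▸ hi)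
    rw [erase_insert_of_ne hai, prod_insert (fun h => ha (mem_of_mem_erase h)), smul_smul]

theorem bell_aux (D : Derivation ℚ (MvPolynomial ℕ ℚ) (MvPolynomial ℕ ℚ))
    (hD : ∀ i, D (X i) = X (i + 1)) (s : Finset α) :
    (fun p => D p + X 1 * p)^[s.card] 1 =
      ∑ π : Finpartition s, ∏ β ∈ π.parts, (X β.card : MvPolynomial ℕ ℚ) := by
  induction s using Finset.induction_on with
  | empty =>
    have : ∀ π : Finpartition (∅ : Finset α), π.parts = ∅ := fun π =>
      π.parts_eq_empty_iff.2 rfl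
    have hc : Fintype.card (Finpartition (∅ : Finset α)) = 1 :=
      Fintype.card_eq_one_iff.2 ⟨Finpartition.empty _, fun y => Finpartition.ext (by rw [this]; rfl)⟩
    simp [this, hc]
  | insert a s ha ih =>
    rw [card_insert_of_notMem ha, Function.iterate_succ_apply', ih,
      sum_insert_partition ha (fun P => ∏ β ∈ P, (X β.card : MvPolynomial ℕ ℚ)),
      map_sum, mul_sum, ← sum_add_distrib]
    refine sum_congr rfl fun P _ => ?_
    have hn : ∀ p ∈ P.parts, a ∉ p := fun p hp h => ha (P.subset hp h)
    have hnew : ∀ β, insert a β ∉ P.parts.erase β := fun β h =>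
      hn _ (mem_of_mem_erase h) (mem_insert_self _ _)
    rw [sum_insert P.empty_notMem_parts, derivation_prod_aux, add_comm]
    congr 1
    · rw [prod_insert (hnew ∅), erase_eq_of_notMem P.empty_notMem_parts]
      simp
    · refine sum_congr rfl fun β hβ => ?_
      rw [prod_insert (hnew β), hD, card_insert_of_notMem (hn β hβ), smul_eq_mul, mul_comm]

end Aux

/-- For every `n`, in `R = MvPolynomial ℕ ℚ` with `D` the derivation sending `X i ↦ X (i+1)`,
the Bell polynomial `Yₙ = (D + X 1)^n (1)` equals the sum over all set partitions `π` of an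
`n`-element set of the product over blocks `β` of `X (card β)`. -/
theorem bell_polynomial_eq_sum_over_partitions
    (n : ℕ) (D : Derivation ℚ (MvPolynomial ℕ ℚ) (MvPolynomial ℕ ℚ))
    (hD : ∀ i, D (X i) = X (i + 1)) :
    (fun p => D p + X 1 * p)^[n] 1 =
      ∑ π : Finpartition (univ : Finset (Fin n)), ∏ β ∈ π.parts, X β.card := by
  have h := bell_aux D hD (univ : Finset (Fin n))
  rw [card_univ, Fintype.card_fin] at h
  convert h
end

section
/- For every natural number n, in the polynomial ring R = MvPolynomial ℕ ℚ with derivation D determined by D(X_i) = X_{i+1}, one has D((D + X_1)^n(1)) = Σ_π ∏_{β ∈ π} X_{|β|}, where the sum is over all set partitions π of [n+1] = {1,…,n+1} in which the singleton {n+1} is NOT a block. (This gives the combinatorial interpretation of the coefficients of the Burgers hierarchy flows: the coefficient of a monomial in D(Y_n) counts set partitions of [n+1] with prescribed block sizes such that the distinguished element n+1 does not constitute a 1-block.) -/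
open Finset MvPolynomial

attribute [local instance] Classical.propDecidable

lemma deriv_prod_aux (D : Derivation ℚ (MvPolynomial ℕ ℚ) (MvPolynomial ℕ ℚ))
    (hD : ∀ i, D (X i) = X (i + 1)) {α : Type*} (P : Finset (Finset α)) :
    D (∏ β ∈ P, X β.card) = ∑ β ∈ P, X (β.card + 1) * ∏ γ ∈ P.erase β, X γ.card := by
  induction P using Finset.induction_on with
  | empty => simp
  | insert b P hb ih =>
    rw [Finset.prod_insert hb, Derivation.leibniz, Finset.sum_insert hb, ih, hD,
      Finset.erase_insert hb, smul_eq_mul, smul_eq_mul, add_comm, mul_comm, Finset.mul_sum]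
    rw [mul_comm]
    congr 1
    refine Finset.sum_congr rfl fun β hβ => ?_
    have hne : b ≠ β := fun h => hb (h ▸ hβ)
    rw [Finset.erase_insert_of_ne hne, Finset.prod_insert (by simp [hb])]
    ring

noncomputable def addP {α : Type*} {s : Finset α} (a : α) (ha : a ∉ s) (π : Finpartition s)
    (β : Finset α) (hβ : β ∈ π.parts) : Finpartition (insert a s) :=
  Finpartition.ofExistsUnique (insert (insert a β) (π.parts.erase β))
    (by
      intro p hp
      have := π.subset hβ
      rcases Finset.mem_insert.1 hp with rfl | hp
      · exact Finset.insert_subset_insert _ this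
      · exact (π.subset (Finset.mem_of_mem_erase hp)).trans (Finset.subset_insert _ _))
    (by
      intro x hx
      rcases Finset.mem_insert.1 hx with rfl | hx
      · refine ⟨insert x β, ⟨by simp, by simp⟩, ?_⟩
        rintro t ⟨ht, hxt⟩
        rcases Finset.mem_insert.1 ht with rfl | ht
        · rfl
        · exact absurd (π.subset (Finset.mem_of_mem_erase ht) hxt) ha
      · have hxa : x ≠ a := fun h => ha (h ▸ hx)
        obtain ⟨t, ht, hxt⟩ := π.exists_mem hx
        by_cases h : t = β
        · subst h
          refine ⟨insert a t, ⟨by simp, by simp [hxt]⟩, ?_⟩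
          rintro u ⟨hu, hxu⟩
          rcases Finset.mem_insert.1 hu with rfl | hu
          · rfl
          · rw [Finset.mem_erase] at hu
            exact absurd (π.eq_of_mem_parts hu.2 ht hxu hxt) hu.1
        · refine ⟨t, ⟨by simp [h, ht], hxt⟩, ?_⟩
          rintro u ⟨hu, hxu⟩
          rcases Finset.mem_insert.1 hu with rfl | hu
          · have : x ∈ β := by simpa [hxa] using hxu
            exact absurd (π.eq_of_mem_parts ht hβ hxt this) h
          · rw [Finset.mem_erase] at hu
            exact π.eq_of_mem_parts hu.2 ht hxu hxt)
    (by
      simp only [Finset.mem_insert, Finset.mem_erase, not_or]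
      exact ⟨(Finset.insert_ne_empty _ _).symm, fun h => π.empty_notMem_parts h.2⟩)

noncomputable def delP {α : Type*} {s : Finset α} (a : α) (ha : a ∉ s)
    (ρ : Finpartition (insert a s)) (h1 : {a} ∉ ρ.parts) : Finpartition s :=
  Finpartition.ofExistsUnique (insert ((ρ.part a).erase a) (ρ.parts.erase (ρ.part a)))
    (by
      intro p hp x hx
      rcases Finset.mem_insert.1 hp with rfl | hp
      · rw [Finset.mem_erase] at hx
        have := ρ.part_subset a hx.2
        simpa [hx.1] using this
      · rw [Finset.mem_erase] at hp
        have := ρ.subset hp.2 hx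
        rcases Finset.mem_insert.1 this with rfl | h
        · exact absurd (ρ.part_eq_of_mem hp.2 hx).symm hp.1
        · exact h)
    (by
      intro x hx
      have hxa : x ≠ a := fun h => ha (h ▸ hx)
      have hx' : x ∈ insert a s := by simp [hx]
      have hpa : ρ.part a ∈ ρ.parts := by simp
      obtain ⟨t, ht, hxt⟩ := ρ.exists_mem hx'
      by_cases h : t = ρ.part a
      · refine ⟨(ρ.part a).erase a, ⟨by simp, by simp [hxa, ← h, hxt]⟩, ?_⟩
        rintro u ⟨hu, hxu⟩
        rcases Finset.mem_insert.1 hu with rfl | hu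
        · rfl
        · rw [Finset.mem_erase] at hu
          exact absurd ((ρ.eq_of_mem_parts hu.2 ht hxu hxt).trans h) hu.1
      · refine ⟨t, ⟨by simp [h, ht], hxt⟩, ?_⟩
        rintro u ⟨hu, hxu⟩
        rcases Finset.mem_insert.1 hu with rfl | hu
        · exact absurd (ρ.eq_of_mem_parts ht hpa hxt (Finset.mem_of_mem_erase hxu)) h
        · rw [Finset.mem_erase] at hu
          exact ρ.eq_of_mem_parts hu.2 ht hxu hxt)
    (by
      have hpa : ρ.part a ∈ ρ.parts := by simp
      have haa : a ∈ ρ.part a := by simp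
      simp only [Finset.mem_insert, Finset.mem_erase, not_or]
      refine ⟨fun h => ?_, fun h => ρ.empty_notMem_parts h.2⟩
      rcases (Finset.erase_eq_empty_iff _ _).1 h.symm with h | h
      · simp [h] at haa
      · exact h1 (h ▸ hpa))

lemma sum_not_singleton (D : Derivation ℚ (MvPolynomial ℕ ℚ) (MvPolynomial ℕ ℚ))
    (hD : ∀ i, D (X i) = X (i + 1)) {α : Type*} (s : Finset α) (a : α) (ha : a ∉ s) :
    D (∑ π : Finpartition s, ∏ β ∈ π.parts, X β.card) =
      ∑ π ∈ (univ.filter (fun π : Finpartition (insert a s) => {a} ∉ π.parts)),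
        ∏ β ∈ π.parts, X β.card := by
  rw [map_sum]
  simp_rw [deriv_prod_aux D hD]
  rw [Finset.sum_sigma']
  have key : ∀ (π : Finpartition s) (β : Finset α) (hβ : β ∈ π.parts),
      (addP a ha π β hβ).part a = insert a β := fun π β hβ =>
    Finpartition.part_eq_of_mem _ (by simp [addP]) (by simp)
  have nota : ∀ (π : Finpartition s) (β : Finset α) (hβ : β ∈ π.parts), a ∉ β :=
    fun π β hβ h => ha (π.subset hβ h)
  have notin : ∀ (π : Finpartition s) (β : Finset α), insert a β ∉ π.parts :=
    fun π β h => ha (π.subset h (by simp))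
  have hpa : ∀ ρ : Finpartition (insert a s), ρ.part a ∈ ρ.parts := fun ρ => by simp
  have haa : ∀ ρ : Finpartition (insert a s), a ∈ ρ.part a := fun ρ => by simp
  have hs : ∀ (π : Finpartition s) (β : Finset α) (hβ : β ∈ π.parts),
      {a} ∉ (addP a ha π β hβ).parts := by
    intro π β hβ h
    have h2 := (addP a ha π β hβ).part_eq_of_mem h (mem_singleton_self a)
    rw [key] at h2
    obtain ⟨x, hx⟩ := π.nonempty_of_mem_parts hβ
    have : x ∈ ({a} : Finset α) := h2 ▸ (Finset.mem_insert_of_mem hx)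
    exact nota π β hβ (Finset.mem_singleton.1 this ▸ hx)
  refine Finset.sum_bij'
    (fun p hp => addP a ha p.1 p.2 (Finset.mem_sigma.1 hp).2)
    (fun ρ hρ => ⟨delP a ha ρ (Finset.mem_filter.1 hρ).2, (ρ.part a).erase a⟩) ?_ ?_ ?_ ?_ ?_
  · rintro ⟨π, β⟩ hp
    exact Finset.mem_filter.2 ⟨Finset.mem_univ _, hs _ _ _⟩
  · intro ρ hρ
    simp [delP]
  · rintro ⟨π, β⟩ hp
    have hβ : β ∈ π.parts := (Finset.mem_sigma.1 hp).2
    have e1 : (insert a β).erase a = β := Finset.erase_insert (nota π β hβ)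
    refine Sigma.ext ?_ (heq_of_eq ?_)
    · apply Finpartition.ext
      simp only [delP, Finpartition.ofExistsUnique_parts]
      rw [key, e1]
      simp only [addP, Finpartition.ofExistsUnique_parts]
      rw [Finset.erase_insert (by simp [notin]), Finset.insert_erase hβ]
    · simp only [key, e1]
  · intro ρ hρ
    apply Finpartition.ext
    simp only [addP, delP, Finpartition.ofExistsUnique_parts]
    rw [Finset.insert_erase (haa ρ), Finset.erase_insert, Finset.insert_erase (hpa ρ)]
    have h1 := (Finset.mem_filter.1 hρ).2
    intro h
    rw [Finset.mem_erase] at h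
    obtain ⟨x, hx⟩ := ρ.nonempty_of_mem_parts h.2
    exact h.1 (ρ.eq_of_mem_parts h.2 (hpa ρ) hx (Finset.mem_of_mem_erase hx))
  · rintro ⟨π, β⟩ hp
    have hβ : β ∈ π.parts := (Finset.mem_sigma.1 hp).2
    simp only [addP, Finpartition.ofExistsUnique_parts]
    rw [Finset.prod_insert (by simp [notin]), Finset.card_insert_of_notMem (nota π β hβ)]

lemma sum_singleton_mem {α : Type*} (s : Finset α) (a : α) (ha : a ∉ s) :
    (X 1 * ∑ π : Finpartition s, ∏ β ∈ π.parts, X β.card : MvPolynomial ℕ ℚ) =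
      ∑ π ∈ (univ.filter (fun π : Finpartition (insert a s) => {a} ∈ π.parts)),
        ∏ β ∈ π.parts, X β.card := by
  rw [Finset.mul_sum]
  have hn : ∀ π : Finpartition s, {a} ∉ π.parts := fun π h => ha (π.subset h (by simp))
  refine Finset.sum_bij
    (fun π _ => π.extend (b := {a}) (c := insert a s) (by simp) (by simpa using ha)
      (by ext; simp)) ?_ ?_ ?_ ?_
  · intro π _
    simp
  · intro π _ π' _ h
    have h2 := congrArg (fun p => p.parts.erase {a}) h
    simp only [Finpartition.extend_parts] at h2
    rw [Finset.erase_insert (hn _), Finset.erase_insert (hn _)] at h2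
    exact Finpartition.ext h2
  · intro ρ hρ
    have h1 : {a} ∈ ρ.parts := (Finset.mem_filter.1 hρ).2
    refine ⟨Finpartition.ofExistsUnique (s := s) (ρ.parts.erase {a}) ?_ ?_ ?_, Finset.mem_univ _, ?_⟩
    · intro p hp x hx
      rw [Finset.mem_erase] at hp
      rcases Finset.mem_insert.1 (ρ.subset hp.2 hx) with rfl | h
      · exact absurd (ρ.eq_of_mem_parts hp.2 h1 hx (by simp)) hp.1
      · exact h
    · intro x hx
      have hxa : x ≠ a := fun h => ha (h ▸ hx)
      obtain ⟨t, ht, hxt⟩ := ρ.exists_mem (Finset.mem_insert_of_mem hx)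
      refine ⟨t, ⟨Finset.mem_erase.2 ⟨?_, ht⟩, hxt⟩, ?_⟩
      · rintro rfl
        exact hxa (Finset.mem_singleton.1 hxt)
      · rintro u ⟨hu, hxu⟩
        exact ρ.eq_of_mem_parts (Finset.mem_of_mem_erase hu) ht hxu hxt
    · exact fun h => ρ.empty_notMem_parts (Finset.mem_of_mem_erase h)
    · apply Finpartition.ext
      simp only [Finpartition.extend_parts, Finpartition.ofExistsUnique_parts]
      exact Finset.insert_erase h1
  · intro π _
    simp only [Finpartition.extend_parts]
    rw [Finset.prod_insert (hn π)]
    simp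

lemma bell_eq (D : Derivation ℚ (MvPolynomial ℕ ℚ) (MvPolynomial ℕ ℚ))
    (hD : ∀ i, D (X i) = X (i + 1)) {α : Type*} (s : Finset α) :
    (fun p => D p + X 1 * p)^[s.card] 1 =
      ∑ π : Finpartition s, ∏ β ∈ π.parts, X β.card := by
  induction s using Finset.induction_on with
  | empty =>
    have : ∀ π : Finpartition (∅ : Finset α), π.parts = ∅ := fun π =>
      π.parts_eq_empty_iff.2 rfl
    have hc : Fintype.card (Finpartition (∅ : Finset α)) = 1 :=
      Fintype.card_eq_one_iff.2 ⟨Finpartition.empty _, fun π =>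
        Finpartition.ext ((this π).trans (this _).symm)⟩
    simp [this, hc]
  | insert a s ha ih =>
    rw [Finset.card_insert_of_notMem ha, Function.iterate_succ_apply', ih,
      sum_not_singleton D hD s a ha, sum_singleton_mem s a ha, add_comm]
    exact Finset.sum_filter_add_sum_filter_not _ _ _

/-- Burgers hierarchy combinatorics: `D (Yₙ)`, where `Yₙ = (D + X 1)^n (1)`, equals the sum over
all set partitions `π` of `[n+1]` in which the singleton `{n+1}` is not a block, of the product
over blocks `β` of `X (card β)`. -/
theorem burgers_eq_sum_over_partitions_no_last_singleton
    (n : ℕ) (D : Derivation ℚ (MvPolynomial ℕ ℚ) (MvPolynomial ℕ ℚ))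
    (hD : ∀ i, D (X i) = X (i + 1)) :
    D ((fun p => D p + X 1 * p)^[n] 1) =
      ∑ π ∈ (univ.filter (fun π : Finpartition (univ : Finset (Fin (n + 1))) =>
          ({Fin.last n} : Finset (Fin (n + 1))) ∉ π.parts)),
        ∏ β ∈ π.parts, X β.card := by
  have h1 := bell_eq D hD ((univ : Finset (Fin (n + 1))).erase (Fin.last n))
  have h2 := sum_not_singleton D hD ((univ : Finset (Fin (n + 1))).erase (Fin.last n))
    (Fin.last n) (by simp)
  have hc : ((univ : Finset (Fin (n + 1))).erase (Fin.last n)).card = n := by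
    rw [Finset.card_erase_of_mem (Finset.mem_univ _), Finset.card_univ, Fintype.card_fin,
      Nat.add_sub_cancel]
  have hu : @insert _ _ (@Finset.instInsert _ (fun a b => Classical.propDecidable (a = b)))
      (Fin.last n) ((univ : Finset (Fin (n + 1))).erase (Fin.last n)) = univ := by
    ext x
    simp [Classical.em]
  rw [← h1, hc, hu] at h2
  convert h2
end

section
/- For every odd natural number n = 2m+1, in the polynomial ring R = MvPolynomial ℕ ℚ with derivation D determined by D(X_i) = X_{i+1}, one has the identity 2·X_0·X_n = D( Σ_{i=0}^{m-1} 2·(−1)^i · X_i · X_{n−1−i} + (−1)^m · X_m^2 ). (For m = 0 this reads 2 X_0 X_1 = D(X_0^2).) -/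
open Finset MvPolynomial

/-- For odd `n = 2m+1`, in `MvPolynomial ℕ ℚ` with `D` the derivation sending `X i ↦ X (i+1)`,
`2·X 0·X n` is the total derivative
`D (Σ_{i=0}^{m-1} 2·(−1)ⁱ·X i·X (n−1−i) + (−1)ᵐ·(X m)²)`. -/
theorem odd_flow_total_derivative
    (m : ℕ) (D : Derivation ℚ (MvPolynomial ℕ ℚ) (MvPolynomial ℕ ℚ))
    (hD : ∀ i, D (X i) = X (i + 1)) :
    2 * X 0 * X (2 * m + 1) =
      D (∑ i ∈ range m, 2 * (-1 : MvPolynomial ℕ ℚ) ^ i * X i * X (2 * m - i)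
          + (-1 : MvPolynomial ℕ ℚ) ^ m * (X m) ^ 2) := by
  have h1 : ∀ i : ℕ, D ((-1 : MvPolynomial ℕ ℚ) ^ i) = 0 := by
    intro i
    rcases neg_one_pow_eq_or (MvPolynomial ℕ ℚ) i with h | h <;> simp [h]
  have h2 : D (2 : MvPolynomial ℕ ℚ) = 0 := by
    exact_mod_cast D.map_natCast 2
  have h3 : ∀ k ≤ m, D (∑ i ∈ range k, 2 * (-1 : MvPolynomial ℕ ℚ) ^ i * X i * X (2 * m - i))
      = 2 * X 0 * X (2 * m + 1) - 2 * (-1 : MvPolynomial ℕ ℚ) ^ k * X k * X (2 * m + 1 - k) := by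
    intro k
    induction k with
    | zero => intro _; simp
    | succ k ih =>
      intro hk
      rw [sum_range_succ, map_add, ih (by omega)]
      simp only [Derivation.leibniz, h1, h2, hD, smul_eq_mul]
      rw [show 2 * m + 1 - k = 2 * m - k + 1 by omega,
        show 2 * m + 1 - (k + 1) = 2 * m - k by omega]
      ring
  rw [map_add, h3 m le_rfl, show 2 * m + 1 - m = m + 1 by omega, pow_two (X m)]
  simp only [Derivation.leibniz, h1, hD, smul_eq_mul]
  ring
end

section
/- For every even natural number n ≥ 2, in the polynomial ring R = MvPolynomial ℕ ℚ with derivation D determined by D(X_i) = X_{i+1}, there is no polynomial P ∈ R with D(P) = X_0·X_n. (That is, for even n the expression 2ψψ_n is not a total x-derivative of a differential polynomial in ψ.) -/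
open MvPolynomial

theorem aux_hasDerivAt
    (D : Derivation ℚ (MvPolynomial ℕ ℚ) (MvPolynomial ℕ ℚ))
    (hD : ∀ i, D (X i) = X (i + 1)) (P : MvPolynomial ℕ ℚ) (x : ℝ) :
    HasDerivAt (fun x : ℝ => aeval (fun i : ℕ => Real.cos (x + i * (Real.pi / 2))) P)
      (aeval (fun i : ℕ => Real.cos (x + i * (Real.pi / 2))) (D P)) x := by
  induction P using MvPolynomial.induction_on with
  | C a =>
    have h : D (C a) = 0 := by
      rw [← MvPolynomial.algebraMap_eq]; exact D.map_algebraMap a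
    simp only [h, map_zero, aeval_C]
    exact hasDerivAt_const _ _
  | add p q hp hq =>
    simp only [map_add]
    exact hp.add hq
  | mul_X p i hp =>
    have h : HasDerivAt (fun x : ℝ => Real.cos (x + i * (Real.pi / 2)))
        (Real.cos (x + ((i + 1 : ℕ) : ℝ) * (Real.pi / 2))) x := by
      have h1 := ((hasDerivAt_id x).add_const ((i : ℝ) * (Real.pi / 2))).cos
      have h2 : x + ((i + 1 : ℕ) : ℝ) * (Real.pi / 2)
          = (x + i * (Real.pi / 2)) + Real.pi / 2 := by push_cast; ring
      rw [h2, Real.cos_add_pi_div_two]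
      simpa using h1
    have h3 := hp.mul h
    simp only [Derivation.leibniz, hD, map_add, map_mul, aeval_X, smul_eq_mul]
    refine HasDerivAt.congr_deriv h3 ?_
    ring

/-- For even `n ≥ 2`, in `MvPolynomial ℕ ℚ` with `D` the derivation sending `X i ↦ X (i+1)`,
there is no differential polynomial `P` with `D P = X 0 · X n`. -/
theorem even_flow_not_total_derivative
    (n : ℕ) (hn : 2 ≤ n) (heven : Even n)
    (D : Derivation ℚ (MvPolynomial ℕ ℚ) (MvPolynomial ℕ ℚ))
    (hD : ∀ i, D (X i) = X (i + 1)) :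
    ¬ ∃ P : MvPolynomial ℕ ℚ, D P = X 0 * X n := by
  rintro ⟨P, hP⟩
  obtain ⟨m, rfl⟩ := heven
  have key := aux_hasDerivAt D hD P
  rw [hP] at key
  set F : ℝ → ℝ := fun x : ℝ => aeval (fun i : ℕ => Real.cos (x + i * (Real.pi / 2))) P with hF
  have hper : F (2 * Real.pi) = F 0 := by
    simp only [hF]
    congr 2
    funext i
    rw [add_comm, Real.cos_add_two_pi, zero_add]
  have hG : ∀ x, HasDerivAt
      (fun x => F x - (-1) ^ m * (x / 2 + Real.sin x * Real.cos x / 2)) 0 x := by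
    intro x
    have h1 := (key x).sub ((((hasDerivAt_id x).div_const 2).add
      (((Real.hasDerivAt_sin x).mul (Real.hasDerivAt_cos x)).div_const 2)).const_mul ((-1 : ℝ) ^ m))
    refine HasDerivAt.congr_deriv h1 ?_
    have h2 : x + ((m + m : ℕ) : ℝ) * (Real.pi / 2) = x + m * Real.pi := by push_cast; ring
    simp only [map_mul, aeval_X, h2, Real.cos_add_nat_mul_pi]
    simp only [Nat.cast_zero, zero_mul, add_zero]
    have := Real.sin_sq_add_cos_sq x
    linear_combination ((-1 : ℝ) ^ m / 2) * this
  have hc := is_const_of_deriv_eq_zero (fun x => (hG x).differentiableAt)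
    (fun x => (hG x).deriv) (2 * Real.pi) 0
  simp only [hper, Real.sin_two_pi, Real.sin_zero] at hc
  have h4 : (-1 : ℝ) ^ m * Real.pi = 0 := by linear_combination -hc
  rcases mul_eq_zero.mp h4 with h | h
  · exact absurd h (pow_ne_zero _ (by norm_num))
  · exact Real.pi_ne_zero h
end

section
/- For every natural number n, in the polynomial ring R = MvPolynomial ℕ ℚ with derivation D determined by D(X_i) = X_{i+1}, the polynomials defined by a_0 = X_0 and a_n = (D + X_0^2)(a_{n−1}) satisfy a_n = Σ_{π ∈ Π^B_n} p_B(π), the sum over all B_n type set partitions π, where p_B(π) = X_{|π_0|₊} · ∏_{j=1}^{k} X_{|π_j|₊ − 1} · X_{|−π_j|₊}. (This identifies the a_n as B-analogs of the full exponential Bell polynomials: the coefficient of each monomial in a_n counts B_n type partitions with the corresponding block structure.) -/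
open Finset MvPolynomial

attribute [local instance] Classical.propDecidable

/-- The negation `−β` of a block `β ⊆ ℤ`. -/
def negBlock (β : Finset ℤ) : Finset ℤ := β.image (fun x => -x)

/-- `π` is a `Bₙ`-type set partition of `{−n, …, n}`: blocks come in pairs `β, −β`, and exactly
one block (the zero block) is symmetric. -/
def IsBType {n : ℕ} (π : Finpartition (Finset.Icc (-(n : ℤ)) (n : ℤ))) : Prop :=
  (∀ β ∈ π.parts, negBlock β ∈ π.parts) ∧
  (π.parts.filter (fun β => negBlock β = β)).card = 1

/-- The number of strictly positive elements of a block. -/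
def posCard (β : Finset ℤ) : ℕ := (β.filter (fun x => 0 < x)).card

/-- The factor contributed by a block `β` to the monomial `p_B(π)`: the symmetric zero block
contributes `X |β|₊`; a block whose element of minimal absolute value is positive contributes
`X (|β|₊ − 1)`; the remaining blocks contribute `X |β|₊`. -/
noncomputable def blockFactor (β : Finset ℤ) : MvPolynomial ℕ ℚ :=
  if negBlock β = β then X (posCard β)
  else if ∃ x ∈ β, 0 < x ∧ ∀ y ∈ β, |x| ≤ |y| then X (posCard β - 1)
  else X (posCard β)

theorem mem_negBlock {β : Finset ℤ} {x : ℤ} : x ∈ negBlock β ↔ -x ∈ β := by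
  simp only [negBlock, mem_image]
  constructor
  · rintro ⟨y, hy, rfl⟩; simpa using hy
  · intro h; exact ⟨-x, h, by simp⟩

theorem negBlock_negBlock (β : Finset ℤ) : negBlock (negBlock β) = β := by
  ext x; simp [mem_negBlock]

/-- The set of blocks `Q` forms a `B_n` partition. -/
structure IsB (n : ℕ) (Q : Finset (Finset ℤ)) : Prop where
  ne : ∀ β ∈ Q, ∃ x, x ∈ β
  disj : ∀ β ∈ Q, ∀ γ ∈ Q, ∀ x, x ∈ β → x ∈ γ → β = γ
  bd : ∀ β ∈ Q, ∀ x ∈ β, -(n : ℤ) ≤ x ∧ x ≤ n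
  cov : ∀ x : ℤ, -(n : ℤ) ≤ x → x ≤ n → ∃ β ∈ Q, x ∈ β
  neg : ∀ β ∈ Q, negBlock β ∈ Q
  zero : ∀ β ∈ Q, negBlock β = β → (0 : ℤ) ∈ β

/-- Extended block. -/
noncomputable def gB (N : ℤ) (β γ : Finset ℤ) : Finset ℤ :=
  γ ∪ (if γ = β then {N} else ∅) ∪ (if γ = negBlock β then {-N} else ∅)

theorem mem_gB {N : ℤ} {β γ : Finset ℤ} {x : ℤ} :
    x ∈ gB N β γ ↔ x ∈ γ ∨ (γ = β ∧ x = N) ∨ (γ = negBlock β ∧ x = -N) := by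
  unfold gB
  simp only [mem_union]
  split_ifs with h1 h2 h2 <;> simp only [mem_singleton, notMem_empty] <;> tauto

/-- Restricted block. -/
noncomputable def rB (n : ℕ) (γ : Finset ℤ) : Finset ℤ :=
  γ.filter (fun x => -(n : ℤ) ≤ x ∧ x ≤ n)

theorem mem_rB {n : ℕ} {γ : Finset ℤ} {x : ℤ} :
    x ∈ rB n γ ↔ x ∈ γ ∧ -(n : ℤ) ≤ x ∧ x ≤ n := by
  simp [rB]

noncomputable def extB (n : ℕ) (Q : Finset (Finset ℤ)) (β : Finset ℤ) : Finset (Finset ℤ) :=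
  Q.image (gB ((n : ℤ) + 1) β)

noncomputable def newB (n : ℕ) (Q : Finset (Finset ℤ)) : Finset (Finset ℤ) :=
  insert {(n : ℤ) + 1} (insert {-((n : ℤ) + 1)} Q)

noncomputable def resB (n : ℕ) (Q : Finset (Finset ℤ)) : Finset (Finset ℤ) :=
  (Q.image (rB n)).erase ∅

theorem negBlock_gB (N : ℤ) (β γ : Finset ℤ) :
    negBlock (gB N β γ) = gB N β (negBlock γ) := by
  ext x
  simp only [mem_negBlock, mem_gB]
  have h1 : negBlock γ = negBlock β ↔ γ = β :=
    ⟨fun h => by rw [← negBlock_negBlock γ, h, negBlock_negBlock], fun h => by rw [h]⟩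
  have h2 : negBlock γ = β ↔ γ = negBlock β :=
    ⟨fun h => by rw [← h, negBlock_negBlock], fun h => by rw [h, negBlock_negBlock]⟩
  have h3 : -x = N ↔ x = -N := by omega
  have h4 : -x = -N ↔ x = N := by omega
  rw [h1, h2, h3, h4]
  tauto

theorem rB_gB {n : ℕ} {Q : Finset (Finset ℤ)} (hQ : IsB n Q) {β γ : Finset ℤ} (hγ : γ ∈ Q) :
    rB n (gB ((n : ℤ) + 1) β γ) = γ := by
  ext x
  simp only [mem_rB, mem_gB]
  constructor
  · rintro ⟨h | ⟨_, h⟩ | ⟨_, h⟩, h1, h2⟩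
    · exact h
    · omega
    · omega
  · intro h
    exact ⟨Or.inl h, hQ.bd γ hγ x h⟩

theorem resB_extB {n : ℕ} {Q : Finset (Finset ℤ)} (hQ : IsB n Q) (β : Finset ℤ) :
    resB n (extB n Q β) = Q := by
  have h : (extB n Q β).image (rB n) = Q := by
    rw [extB, image_image]
    conv_rhs => rw [← image_id (s := Q)]
    exact image_congr fun γ hγ => rB_gB hQ hγ
  rw [resB, h]
  apply erase_eq_of_notMem
  intro h0
  obtain ⟨x, hx⟩ := hQ.ne _ h0
  simp at hx

theorem resB_newB {n : ℕ} {Q : Finset (Finset ℤ)} (hQ : IsB n Q) :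
    resB n (newB n Q) = Q := by
  have h : Q.image (rB n) = Q := by
    conv_rhs => rw [← image_id (s := Q)]
    refine image_congr fun γ hγ => ?_
    ext x
    simp only [mem_rB, id]
    exact ⟨fun h => h.1, fun h => ⟨h, hQ.bd γ hγ x h⟩⟩
  have h1 : rB n {(n : ℤ) + 1} = ∅ := by
    ext x; simp only [mem_rB, mem_singleton, notMem_empty, iff_false]; omega
  have h2 : rB n {-((n : ℤ) + 1)} = ∅ := by
    ext x; simp only [mem_rB, mem_singleton, notMem_empty, iff_false]; omega
  have h0 : ∅ ∉ Q := by
    intro h0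
    obtain ⟨x, hx⟩ := hQ.ne _ h0
    simp at hx
  rw [resB, newB, image_insert, image_insert, h, h1, h2]
  simp [h0]

theorem isB_newB {n : ℕ} {Q : Finset (Finset ℤ)} (hQ : IsB n Q) : IsB (n + 1) (newB n Q) := by
  have e1 : negBlock {(n : ℤ) + 1} = {-((n : ℤ) + 1)} := by simp [negBlock]
  have e2 : negBlock {-((n : ℤ) + 1)} = {(n : ℤ) + 1} := by rw [← e1, negBlock_negBlock]
  have hb := hQ.bd
  constructor
  · intro β hβ
    simp only [newB, mem_insert] at hβ
    rcases hβ with rfl | rfl | hβ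
    · exact ⟨_, mem_singleton_self _⟩
    · exact ⟨_, mem_singleton_self _⟩
    · exact hQ.ne β hβ
  · intro β hβ γ hγ x hxβ hxγ
    simp only [newB, mem_insert] at hβ hγ
    rcases hβ with rfl | rfl | hβ <;> rcases hγ with rfl | rfl | hγ <;>
      (try simp only [mem_singleton] at hxβ hxγ)
    · rfl
    · omega
    · have := hb _ hγ _ hxγ; omega
    · omega
    · rfl
    · have := hb _ hγ _ hxγ; omega
    · have := hb _ hβ _ hxβ; omega
    · have := hb _ hβ _ hxβ; omega
    · exact hQ.disj _ hβ _ hγ _ hxβ hxγ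
  · intro β hβ x hx
    simp only [newB, mem_insert] at hβ
    push_cast
    rcases hβ with rfl | rfl | hβ
    · simp only [mem_singleton] at hx; omega
    · simp only [mem_singleton] at hx; omega
    · have := hb _ hβ _ hx; omega
  · intro x h1 h2
    push_cast at h1 h2
    by_cases hx1 : x = n + 1
    · exact ⟨{(n : ℤ) + 1}, by simp [newB], by rw [hx1]; exact mem_singleton_self _⟩
    by_cases hx2 : x = -(n + 1)
    · exact ⟨{-((n : ℤ) + 1)}, by simp [newB], by rw [hx2]; exact mem_singleton_self _⟩
    obtain ⟨β, hβ, hx⟩ := hQ.cov x (by omega) (by omega)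
    exact ⟨β, by simp [newB, hβ], hx⟩
  · intro β hβ
    simp only [newB, mem_insert] at hβ ⊢
    rcases hβ with rfl | rfl | hβ
    · rw [e1]; simp
    · rw [e2]; simp
    · right; right; exact hQ.neg _ hβ
  · intro β hβ h
    simp only [newB, mem_insert] at hβ
    rcases hβ with rfl | rfl | hβ
    · rw [e1, singleton_inj] at h; omega
    · rw [e2, singleton_inj] at h; omega
    · exact hQ.zero _ hβ h

theorem isB_extB {n : ℕ} {Q : Finset (Finset ℤ)} (hQ : IsB n Q) {β : Finset ℤ} (hβ : β ∈ Q) :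
    IsB (n + 1) (extB n Q β) := by
  have hb := hQ.bd
  constructor
  · intro B hB
    obtain ⟨γ, hγ, rfl⟩ := mem_image.1 hB
    obtain ⟨x, hx⟩ := hQ.ne γ hγ
    exact ⟨x, mem_gB.2 (Or.inl hx)⟩
  · intro B hB C hC x hxB hxC
    obtain ⟨γ, hγ, rfl⟩ := mem_image.1 hB
    obtain ⟨δ, hδ, rfl⟩ := mem_image.1 hC
    congr 1
    rw [mem_gB] at hxB hxC
    rcases hxB with h | ⟨h, h'⟩ | ⟨h, h'⟩ <;> rcases hxC with k | ⟨k, k'⟩ | ⟨k, k'⟩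
    · exact hQ.disj _ hγ _ hδ _ h k
    · have := hb _ hγ _ h; omega
    · have := hb _ hγ _ h; omega
    · have := hb _ hδ _ k; omega
    · rw [h, k]
    · omega
    · have := hb _ hδ _ k; omega
    · omega
    · rw [h, k]
  · intro B hB x hx
    obtain ⟨γ, hγ, rfl⟩ := mem_image.1 hB
    rw [mem_gB] at hx
    push_cast
    rcases hx with h | ⟨h, h'⟩ | ⟨h, h'⟩
    · have := hb _ hγ _ h; omega
    · omega
    · omega
  · intro x h1 h2
    push_cast at h1 h2
    by_cases hx1 : x = n + 1
    · exact ⟨_, mem_image_of_mem _ hβ, mem_gB.2 (Or.inr (Or.inl ⟨rfl, hx1⟩))⟩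
    by_cases hx2 : x = -(n + 1)
    · exact ⟨_, mem_image_of_mem _ (hQ.neg _ hβ), mem_gB.2 (Or.inr (Or.inr ⟨rfl, hx2⟩))⟩
    obtain ⟨γ, hγ, hx⟩ := hQ.cov x (by omega) (by omega)
    exact ⟨_, mem_image_of_mem _ hγ, mem_gB.2 (Or.inl hx)⟩
  · intro B hB
    obtain ⟨γ, hγ, rfl⟩ := mem_image.1 hB
    rw [negBlock_gB]
    exact mem_image_of_mem _ (hQ.neg _ hγ)
  · intro B hB h
    obtain ⟨γ, hγ, rfl⟩ := mem_image.1 hB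
    rw [negBlock_gB] at h
    have := congrArg (rB n) h
    rw [rB_gB hQ hγ, rB_gB hQ (hQ.neg _ hγ)] at this
    exact mem_gB.2 (Or.inl (hQ.zero _ hγ this))

theorem negBlock_rB (n : ℕ) (γ : Finset ℤ) : negBlock (rB n γ) = rB n (negBlock γ) := by
  ext x
  simp only [mem_negBlock, mem_rB]
  constructor <;> rintro ⟨h, h1, h2⟩ <;> exact ⟨h, by omega, by omega⟩

theorem mem_resB {n : ℕ} {Q : Finset (Finset ℤ)} {γ : Finset ℤ} :
    γ ∈ resB n Q ↔ (∃ x, x ∈ γ) ∧ ∃ B ∈ Q, rB n B = γ := by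
  rw [resB, mem_erase, mem_image, ← nonempty_iff_ne_empty]; rfl

theorem isB_resB {n : ℕ} {Q : Finset (Finset ℤ)} (hQ : IsB (n + 1) Q) : IsB n (resB n Q) := by
  constructor
  · intro β hβ; exact (mem_resB.1 hβ).1
  · intro β hβ γ hγ x hxβ hxγ
    obtain ⟨_, B, hB, rfl⟩ := mem_resB.1 hβ
    obtain ⟨_, C, hC, rfl⟩ := mem_resB.1 hγ
    rw [hQ.disj B hB C hC x (mem_rB.1 hxβ).1 (mem_rB.1 hxγ).1]
  · intro β hβ x hx
    obtain ⟨_, B, hB, rfl⟩ := mem_resB.1 hβ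
    exact (mem_rB.1 hx).2
  · intro x h1 h2
    obtain ⟨B, hB, hx⟩ := hQ.cov x (by push_cast; omega) (by push_cast; omega)
    have : x ∈ rB n B := mem_rB.2 ⟨hx, h1, h2⟩
    exact ⟨rB n B, mem_resB.2 ⟨⟨x, this⟩, B, hB, rfl⟩, this⟩
  · intro β hβ
    obtain ⟨⟨x, hx⟩, B, hB, rfl⟩ := mem_resB.1 hβ
    refine mem_resB.2 ⟨⟨-x, mem_negBlock.2 (by simpa using hx)⟩, negBlock B, hQ.neg _ hB, ?_⟩
    rw [negBlock_rB]
  · intro β hβ h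
    obtain ⟨⟨x, hx⟩, B, hB, rfl⟩ := mem_resB.1 hβ
    have h1 : -x ∈ rB n B := by rw [← h, mem_negBlock]; simpa using hx
    have h2 : negBlock B = B :=
      hQ.disj _ (hQ.neg _ hB) _ hB x (mem_negBlock.2 (mem_rB.1 h1).1) (mem_rB.1 hx).1
    exact mem_rB.2 ⟨hQ.zero _ hB h2, by omega, by omega⟩

theorem exists_ext {n : ℕ} {Q : Finset (Finset ℤ)} (hQ : IsB (n + 1) Q) :
    Q = newB n (resB n Q) ∨ ∃ β ∈ resB n Q, Q = extB n (resB n Q) β := by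
  have hb : ∀ β ∈ Q, ∀ x ∈ β, x = (n : ℤ) + 1 ∨ x = -((n : ℤ) + 1) ∨ (-(n : ℤ) ≤ x ∧ x ≤ n) := by
    intro β hβ x hx
    have := hQ.bd β hβ x hx
    push_cast at this
    omega
  obtain ⟨B, hB, hNB⟩ := hQ.cov ((n : ℤ) + 1) (by push_cast; omega) (by push_cast; omega)
  have hNB' : -((n : ℤ) + 1) ∈ negBlock B := mem_negBlock.2 (by simpa using hNB)
  have hnB := hQ.neg _ hB
  by_cases h0 : ∃ x, x ∈ rB n B
  · right
    have hβ : rB n B ∈ resB n Q := mem_resB.2 ⟨h0, B, hB, rfl⟩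
    have hn0 : ∃ x, x ∈ rB n (negBlock B) := by
      obtain ⟨x, hx⟩ := h0
      exact ⟨-x, by rw [← negBlock_rB, mem_negBlock]; simpa using hx⟩
    refine ⟨_, hβ, ?_⟩
    have inj : ∀ C ∈ Q, ∀ E ∈ Q, (∃ x, x ∈ rB n E) → rB n C = rB n E → C = E := by
      rintro C hC E hE ⟨x, hx⟩ h
      exact hQ.disj _ hC _ hE x (mem_rB.1 (h ▸ hx)).1 (mem_rB.1 hx).1
    have key : ∀ C ∈ Q, gB ((n : ℤ) + 1) (rB n B) (rB n C) = C := by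
      intro C hC
      ext x
      rw [mem_gB, negBlock_rB]
      constructor
      · rintro (h | ⟨h, rfl⟩ | ⟨h, rfl⟩)
        · exact (mem_rB.1 h).1
        · rw [inj C hC B hB h0 h]; exact hNB
        · rw [inj C hC _ hnB hn0 h]; exact hNB'
      · intro hx
        rcases hb C hC x hx with rfl | rfl | h
        · right; left; rw [hQ.disj C hC B hB _ hx hNB]; simp
        · right; right; rw [hQ.disj C hC _ hnB _ hx hNB']; simp
        · left; exact mem_rB.2 ⟨hx, h⟩
    ext C
    rw [extB, mem_image]
    constructor
    · intro hC
      refine ⟨rB n C, mem_resB.2 ⟨?_, C, hC, rfl⟩, key C hC⟩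
      obtain ⟨x, hx⟩ := hQ.ne C hC
      rcases hb C hC x hx with rfl | rfl | h
      · rw [hQ.disj C hC B hB _ hx hNB]; exact h0
      · rw [hQ.disj C hC _ hnB _ hx hNB']; exact hn0
      · exact ⟨x, mem_rB.2 ⟨hx, h⟩⟩
    · rintro ⟨γ, hγ, rfl⟩
      obtain ⟨_, E, hE, rfl⟩ := mem_resB.1 hγ
      rw [key E hE]; exact hE
  · left
    push Not at h0
    have hB1 : B = {(n : ℤ) + 1} := by
      ext x
      rw [mem_singleton]
      constructor
      · intro hx
        rcases hb B hB x hx with rfl | rfl | h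
        · rfl
        · exfalso
          have h2 := hQ.disj _ hB _ hnB _ hx hNB'
          exact h0 0 (mem_rB.2 ⟨hQ.zero _ hB h2.symm, by omega, by omega⟩)
        · exact absurd (mem_rB.2 ⟨hx, h⟩) (h0 x)
      · rintro rfl; exact hNB
    have hB2 : negBlock B = {-((n : ℤ) + 1)} := by rw [hB1]; simp [negBlock]
    have key : ∀ C ∈ Q, C ≠ B → C ≠ negBlock B → rB n C = C := by
      intro C hC h1 h2
      ext x
      rw [mem_rB]
      refine ⟨fun h => h.1, fun hx => ⟨hx, ?_⟩⟩
      rcases hb C hC x hx with rfl | rfl | h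
      · exact absurd (hQ.disj C hC B hB _ hx hNB) h1
      · exact absurd (hQ.disj C hC _ hnB _ hx hNB') h2
      · exact h
    ext C
    rw [newB, ← hB1, ← hB2, mem_insert, mem_insert]
    constructor
    · intro hC
      by_cases h1 : C = B
      · exact Or.inl h1
      by_cases h2 : C = negBlock B
      · exact Or.inr (Or.inl h2)
      exact Or.inr (Or.inr (mem_resB.2 ⟨hQ.ne C hC, C, hC, key C hC h1 h2⟩))
    · rintro (rfl | rfl | h)
      · exact hB
      · exact hnB
      · obtain ⟨⟨x, hx⟩, E, hE, rfl⟩ := mem_resB.1 h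
        rw [key E hE]
        · exact hE
        · rintro rfl; exact h0 x hx
        · rintro rfl
          rw [← negBlock_rB, mem_negBlock] at hx
          exact h0 _ hx

theorem newB_ne_extB {n : ℕ} {Q : Finset (Finset ℤ)} (hQ : IsB n Q) (β : Finset ℤ) :
    newB n Q ≠ extB n Q β := by
  intro h
  have h1 : {(n : ℤ) + 1} ∈ extB n Q β := by rw [← h]; simp [newB]
  obtain ⟨γ, hγ, h2⟩ := mem_image.1 h1
  obtain ⟨x, hx⟩ := hQ.ne γ hγ
  have h3 : x ∈ gB ((n : ℤ) + 1) β γ := mem_gB.2 (Or.inl hx)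
  rw [h2, mem_singleton] at h3
  have := hQ.bd γ hγ x hx
  omega

theorem extB_inj {n : ℕ} {Q : Finset (Finset ℤ)} (hQ : IsB n Q) {β γ : Finset ℤ}
    (hβ : β ∈ Q) (hγ : γ ∈ Q) (h : extB n Q β = extB n Q γ) : β = γ := by
  have h1 : gB ((n : ℤ) + 1) β β ∈ extB n Q γ := by rw [← h]; exact mem_image_of_mem _ hβ
  have h2 : gB ((n : ℤ) + 1) γ γ ∈ extB n Q γ := mem_image_of_mem _ hγ
  have h3 := (isB_extB hQ hγ).disj _ h1 _ h2 ((n : ℤ) + 1)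
    (mem_gB.2 (Or.inr (Or.inl ⟨rfl, rfl⟩))) (mem_gB.2 (Or.inr (Or.inl ⟨rfl, rfl⟩)))
  have := congrArg (rB n) h3
  rwa [rB_gB hQ hβ, rB_gB hQ hγ] at this

/-- The children of a partition. -/
noncomputable def childB (n : ℕ) (Q : Finset (Finset ℤ)) : Finset (Finset (Finset ℤ)) :=
  insert (newB n Q) (Q.image (extB n Q))

noncomputable def UB : ℕ → Finset (Finset (Finset ℤ))
  | 0 => {{{0}}}
  | n + 1 => (UB n).biUnion (childB n)

theorem mem_UB (n : ℕ) (Q : Finset (Finset ℤ)) : Q ∈ UB n ↔ IsB n Q := by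
  induction n generalizing Q with
  | zero =>
    rw [UB, mem_singleton]
    constructor
    · rintro rfl
      constructor <;> simp [negBlock] <;> omega
    · intro hQ
      have h : ∀ β ∈ Q, β = {0} := by
        intro β hβ
        have h1 : ∀ x ∈ β, x = 0 := by
          intro x hx
          have := hQ.bd β hβ x hx
          push_cast at this
          omega
        obtain ⟨x, hx⟩ := hQ.ne β hβ
        ext y
        rw [mem_singleton]
        refine ⟨h1 y, ?_⟩
        rintro rfl
        rw [← h1 x hx]; exact hx
      obtain ⟨β, hβ, _⟩ := hQ.cov 0 (by simp) (by simp)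
      ext C
      rw [mem_singleton]
      refine ⟨h C, ?_⟩
      rintro rfl
      rw [← h β hβ]; exact hβ
  | succ n ih =>
    rw [UB, mem_biUnion]
    constructor
    · rintro ⟨P, hP, hQ⟩
      rw [ih] at hP
      rw [childB, mem_insert, mem_image] at hQ
      rcases hQ with rfl | ⟨β, hβ, rfl⟩
      · exact isB_newB hP
      · exact isB_extB hP hβ
    · intro hQ
      refine ⟨resB n Q, (ih _).2 (isB_resB hQ), ?_⟩
      rw [childB, mem_insert, mem_image]
      rcases exists_ext hQ with h | ⟨β, hβ, h⟩
      · exact Or.inl h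
      · exact Or.inr ⟨β, hβ, h.symm⟩

theorem resB_child {n : ℕ} {P Q : Finset (Finset ℤ)} (hP : IsB n P) (h : Q ∈ childB n P) :
    resB n Q = P := by
  rw [childB, mem_insert, mem_image] at h
  rcases h with rfl | ⟨β, hβ, rfl⟩
  · exact resB_newB hP
  · exact resB_extB hP β

theorem blockFactor_sing_pos (n : ℕ) : blockFactor {(n : ℤ) + 1} = X 0 := by
  have h1 : negBlock {(n : ℤ) + 1} ≠ {(n : ℤ) + 1} := by
    simp only [negBlock, image_singleton, ne_eq, singleton_inj]; omega
  have h2 : ∃ x ∈ ({(n : ℤ) + 1} : Finset ℤ), 0 < x ∧ ∀ y ∈ ({(n : ℤ) + 1} : Finset ℤ), |x| ≤ |y| :=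
    ⟨(n : ℤ) + 1, by simp, by omega, by simp⟩
  have h3 : posCard {(n : ℤ) + 1} = 1 := by
    rw [posCard, filter_singleton, if_pos (by omega)]; simp
  rw [blockFactor, if_neg h1, if_pos h2, h3]

theorem blockFactor_sing_neg (n : ℕ) : blockFactor {-((n : ℤ) + 1)} = X 0 := by
  have h1 : negBlock {-((n : ℤ) + 1)} ≠ {-((n : ℤ) + 1)} := by
    simp only [negBlock, image_singleton, ne_eq, singleton_inj]; omega
  have h2 : ¬ ∃ x ∈ ({-((n : ℤ) + 1)} : Finset ℤ), 0 < x ∧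
      ∀ y ∈ ({-((n : ℤ) + 1)} : Finset ℤ), |x| ≤ |y| := by
    rintro ⟨x, hx, h, _⟩
    rw [mem_singleton] at hx; omega
  have h3 : posCard {-((n : ℤ) + 1)} = 0 := by
    rw [posCard, filter_singleton, if_neg (by omega)]; simp
  rw [blockFactor, if_neg h1, if_neg h2, h3]

theorem prod_newB {n : ℕ} {Q : Finset (Finset ℤ)} (hQ : IsB n Q) :
    ∏ β ∈ newB n Q, blockFactor β = (X 0) ^ 2 * ∏ β ∈ Q, blockFactor β := by
  have h1 : {(n : ℤ) + 1} ∉ Q := fun h => by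
    have := hQ.bd _ h _ (mem_singleton_self _); omega
  have h2 : {-((n : ℤ) + 1)} ∉ Q := fun h => by
    have := hQ.bd _ h _ (mem_singleton_self _); omega
  have h3 : ({(n : ℤ) + 1} : Finset ℤ) ≠ {-((n : ℤ) + 1)} := by
    rw [ne_eq, singleton_inj]; omega
  rw [newB, prod_insert (by simp only [mem_insert, not_or]; exact ⟨h3, h1⟩), prod_insert h2,
    blockFactor_sing_pos, blockFactor_sing_neg]
  ring

theorem posCard_gB {n : ℕ} {Q : Finset (Finset ℤ)} (hQ : IsB n Q) {β γ : Finset ℤ}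
    (hγ : γ ∈ Q) :
    posCard (gB ((n : ℤ) + 1) β γ) = posCard γ + if γ = β then 1 else 0 := by
  unfold posCard
  split_ifs with h
  · rw [← card_insert_of_notMem (a := (n : ℤ) + 1) (s := γ.filter (fun x => 0 < x))]
    · congr 1
      ext x
      simp only [mem_filter, mem_gB, mem_insert]
      constructor
      · rintro ⟨h1 | ⟨_, h1⟩ | ⟨_, h1⟩, h2⟩
        · exact Or.inr ⟨h1, h2⟩
        · exact Or.inl h1
        · omega
      · rintro (h1 | h1)
        · exact ⟨Or.inr (Or.inl ⟨h, h1⟩), by omega⟩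
        · exact ⟨Or.inl h1.1, h1.2⟩
    · intro h'
      have := hQ.bd γ hγ _ (mem_filter.1 h').1
      omega
  · rw [add_zero]
    congr 1
    ext x
    simp only [mem_filter, mem_gB]
    constructor
    · rintro ⟨h1 | ⟨h1, _⟩ | ⟨_, h1⟩, h2⟩
      · exact ⟨h1, h2⟩
      · exact absurd h1 h
      · omega
    · rintro ⟨h1, h2⟩; exact ⟨Or.inl h1, h2⟩

theorem blockFactor_gB {n : ℕ} {Q : Finset (Finset ℤ)} (hQ : IsB n Q) {β γ : Finset ℤ}
    (hγ : γ ∈ Q) (D : Derivation ℚ (MvPolynomial ℕ ℚ) (MvPolynomial ℕ ℚ))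
    (hD : ∀ i, D (X i) = X (i + 1)) :
    blockFactor (gB ((n : ℤ) + 1) β γ) =
      if γ = β then D (blockFactor γ) else blockFactor γ := by
  have e1 : negBlock (gB ((n : ℤ) + 1) β γ) = gB ((n : ℤ) + 1) β γ ↔ negBlock γ = γ := by
    rw [negBlock_gB]
    constructor
    · intro h
      have := congrArg (rB n) h
      rwa [rB_gB hQ hγ, rB_gB hQ (hQ.neg _ hγ)] at this
    · intro h; rw [h]
  have hb : ∀ x ∈ γ, |x| ≤ n := fun x hx => abs_le.2 (hQ.bd γ hγ x hx)
  have a1 : |(n : ℤ) + 1| = n + 1 := abs_of_nonneg (by omega)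
  have a2 : |-((n : ℤ) + 1)| = n + 1 := by rw [abs_neg, a1]
  have e2 : (∃ x ∈ gB ((n : ℤ) + 1) β γ, 0 < x ∧ ∀ y ∈ gB ((n : ℤ) + 1) β γ, |x| ≤ |y|) ↔
      ∃ x ∈ γ, 0 < x ∧ ∀ y ∈ γ, |x| ≤ |y| := by
    obtain ⟨z, hz⟩ := hQ.ne γ hγ
    have hzb := hb z hz
    constructor
    · rintro ⟨x, hx, h0, h⟩
      have h1 := h z (mem_gB.2 (Or.inl hz))
      refine ⟨x, ?_, h0, fun y hy => h y (mem_gB.2 (Or.inl hy))⟩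
      rcases mem_gB.1 hx with h2 | ⟨_, rfl⟩ | ⟨_, rfl⟩
      · exact h2
      · omega
      · omega
    · rintro ⟨x, hx, h0, h⟩
      have h1 := hb x hx
      refine ⟨x, mem_gB.2 (Or.inl hx), h0, fun y hy => ?_⟩
      rcases mem_gB.1 hy with h2 | ⟨_, rfl⟩ | ⟨_, rfl⟩
      · exact h y h2
      · omega
      · omega
  have e3 : (∃ x ∈ γ, 0 < x ∧ ∀ y ∈ γ, |x| ≤ |y|) → 0 < posCard γ := by
    rintro ⟨x, hx, h0, _⟩
    exact card_pos.2 ⟨x, mem_filter.2 ⟨hx, h0⟩⟩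
  unfold blockFactor
  rw [posCard_gB hQ hγ]
  simp only [e1, e2]
  by_cases hγβ : γ = β
  · simp only [if_pos hγβ]
    split_ifs with h1 h2
    · rw [hD]
    · rw [hD]; have := e3 h2; congr 1; omega
    · rw [hD]
  · simp only [if_neg hγβ, add_zero]

theorem prod_extB {n : ℕ} {Q : Finset (Finset ℤ)} (hQ : IsB n Q) {β : Finset ℤ}
    (hβ : β ∈ Q) (D : Derivation ℚ (MvPolynomial ℕ ℚ) (MvPolynomial ℕ ℚ))
    (hD : ∀ i, D (X i) = X (i + 1)) :
    ∏ B ∈ extB n Q β, blockFactor B = (∏ γ ∈ Q.erase β, blockFactor γ) * D (blockFactor β) := by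
  rw [extB, prod_image]
  · rw [← prod_erase_mul _ _ hβ, blockFactor_gB hQ hβ D hD, if_pos rfl]
    congr 1
    refine prod_congr rfl fun γ hγ => ?_
    rw [blockFactor_gB hQ (mem_of_mem_erase hγ) D hD, if_neg (ne_of_mem_erase hγ)]
  · intro γ hγ δ hδ h
    have := congrArg (rB n) h
    rwa [rB_gB hQ hγ, rB_gB hQ hδ] at this

theorem deriv_prod (D : Derivation ℚ (MvPolynomial ℕ ℚ) (MvPolynomial ℕ ℚ))
    (Q : Finset (Finset ℤ)) (f : Finset ℤ → MvPolynomial ℕ ℚ) :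
    D (∏ β ∈ Q, f β) = ∑ β ∈ Q, (∏ γ ∈ Q.erase β, f γ) * D (f β) := by
  induction Q using Finset.induction_on with
  | empty => simp
  | insert a s ha ih =>
    rw [prod_insert ha, D.leibniz, ih, sum_insert ha, erase_insert ha, smul_eq_mul, smul_eq_mul,
      add_comm, mul_sum]
    congr 1
    refine sum_congr rfl fun β hβ => ?_
    have hne : a ≠ β := fun h => ha (h ▸ hβ)
    rw [erase_insert_of_ne hne, prod_insert (fun h => ha (mem_of_mem_erase h))]
    ring

theorem sum_UB (n : ℕ) (D : Derivation ℚ (MvPolynomial ℕ ℚ) (MvPolynomial ℕ ℚ))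
    (hD : ∀ i, D (X i) = X (i + 1))
    (a : ℕ → MvPolynomial ℕ ℚ)
    (ha0 : a 0 = X 0)
    (ha : ∀ m, a (m + 1) = D (a m) + (X 0) ^ 2 * a m) :
    a n = ∑ Q ∈ UB n, ∏ β ∈ Q, blockFactor β := by
  induction n with
  | zero =>
    rw [ha0, UB, sum_singleton, prod_singleton, blockFactor, if_pos (by simp [negBlock])]
    simp [posCard, filter_singleton]
  | succ n ih =>
    rw [ha, ih, UB, sum_biUnion]
    · rw [map_sum, mul_sum, ← sum_add_distrib]
      refine sum_congr rfl fun Q hQ => ?_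
      have hQ := (mem_UB n Q).1 hQ
      rw [childB, sum_insert, prod_newB hQ, add_comm, deriv_prod, sum_image]
      · congr 1
        exact sum_congr rfl fun β hβ => (prod_extB hQ hβ D hD).symm
      · intro β hβ γ hγ h
        exact extB_inj hQ hβ hγ h
      · rw [mem_image]
        rintro ⟨β, _, h⟩
        exact newB_ne_extB hQ β h.symm
    · intro P hP Q hQ hne
      refine disjoint_left.2 fun R hR1 hR2 => hne ?_
      rw [← resB_child ((mem_UB n P).1 hP) hR1, ← resB_child ((mem_UB n Q).1 hQ) hR2]

theorem isB_of_isBType {n : ℕ} (π : Finpartition (Finset.Icc (-(n : ℤ)) (n : ℤ)))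
    (h : IsBType π) : IsB n π.parts := by
  have hdisj : ∀ β ∈ π.parts, ∀ γ ∈ π.parts, ∀ x, x ∈ β → x ∈ γ → β = γ :=
    fun β hβ γ hγ x h1 h2 => π.eq_of_mem_parts hβ hγ h1 h2
  have hcov : ∀ x : ℤ, -(n : ℤ) ≤ x → x ≤ n → ∃ β ∈ π.parts, x ∈ β :=
    fun x h1 h2 => π.exists_mem (mem_Icc.2 ⟨h1, h2⟩)
  refine ⟨fun β hβ => π.nonempty_of_mem_parts hβ, hdisj,
    fun β hβ x hx => mem_Icc.1 (π.le hβ hx), hcov, h.1, ?_⟩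
  intro β hβ hs
  obtain ⟨γ, hγ, h0⟩ := hcov 0 (by omega) (by omega)
  have hs' : negBlock γ = γ := hdisj _ (h.1 γ hγ) _ hγ 0 (mem_negBlock.2 (by simpa using h0)) h0
  have := card_le_one.1 h.2.le β (mem_filter.2 ⟨hβ, hs⟩) γ (mem_filter.2 ⟨hγ, hs'⟩)
  rw [this]; exact h0

theorem exists_of_isB {n : ℕ} {Q : Finset (Finset ℤ)} (hQ : IsB n Q) :
    ∃ π : Finpartition (Finset.Icc (-(n : ℤ)) (n : ℤ)), IsBType π ∧ π.parts = Q := by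
  refine ⟨⟨Q, ?_, ?_, ?_⟩, ⟨hQ.neg, ?_⟩, rfl⟩
  · rw [Finset.supIndep_iff_pairwiseDisjoint]
    intro β hβ γ hγ hne
    exact disjoint_left.2 fun x h1 h2 => hne (hQ.disj β hβ γ hγ x h1 h2)
  · ext x
    rw [mem_sup, mem_Icc]
    constructor
    · rintro ⟨β, hβ, hx⟩; exact hQ.bd β hβ x hx
    · rintro ⟨h1, h2⟩; exact hQ.cov x h1 h2
  · intro h
    obtain ⟨x, hx⟩ := hQ.ne _ h
    simp at hx
  · obtain ⟨γ, hγ, h0⟩ := hQ.cov 0 (by omega) (by omega)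
    have hs' : negBlock γ = γ :=
      hQ.disj _ (hQ.neg γ hγ) _ hγ 0 (mem_negBlock.2 (by simpa using h0)) h0
    refine card_eq_one.2 ⟨γ, ?_⟩
    ext δ
    rw [mem_filter, mem_singleton]
    constructor
    · rintro ⟨h1, h2⟩
      exact hQ.disj _ h1 _ hγ 0 (hQ.zero _ h1 h2) h0
    · rintro rfl; exact ⟨hγ, hs'⟩

/-- The polynomials `a 0 = X 0`, `a n = (D + (X 0)²) (a (n−1))` are the `B`-analogues of the Bell
polynomials: `a n` is the sum over all `Bₙ`-type set partitions `π` of the monomial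
`p_B(π) = X |π₀|₊ · ∏_{j=1}^{k} X (|π_j|₊ − 1) · X (|−π_j|₊)`. -/
theorem ibragimov_shabat_eq_sum_over_B_partitions
    (n : ℕ) (D : Derivation ℚ (MvPolynomial ℕ ℚ) (MvPolynomial ℕ ℚ))
    (hD : ∀ i, D (X i) = X (i + 1))
    (a : ℕ → MvPolynomial ℕ ℚ)
    (ha0 : a 0 = X 0)
    (ha : ∀ m, a (m + 1) = D (a m) + (X 0) ^ 2 * a m) :
    a n = ∑ π ∈ (univ.filter
        (fun π : Finpartition (Finset.Icc (-(n : ℤ)) (n : ℤ)) => IsBType π)),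
      ∏ β ∈ π.parts, blockFactor β := by
  rw [sum_UB n D hD a ha0 ha]
  symm
  refine sum_bij (fun π _ => π.parts) ?_ ?_ ?_ ?_
  · intro π hπ
    exact (mem_UB n _).2 (isB_of_isBType π (mem_filter.1 hπ).2)
  · intro π _ ρ _ h
    exact Finpartition.ext h
  · intro Q hQ
    obtain ⟨π, h1, h2⟩ := exists_of_isB ((mem_UB n Q).1 hQ)
    exact ⟨π, mem_filter.2 ⟨mem_univ _, h1⟩, h2⟩
  · intro π _
    rfl
end

section
/- For every natural number n ≥ 1, in the polynomial ring R = MvPolynomial ℕ ℚ with derivation D determined by D(X_i) = X_{i+1}, the polynomials defined by f_1 = X_0 and f_{n+1} = D(f_n) + Σ_{s=1}^{n−1} f_s·f_{n−s} satisfy f_n = Σ_{a ∈ Φ_n} expand(a), the sum over all expressions a of size n. (In other words, the coefficient of any monomial in f_n equals the number of expressions built from the symbols u, d_j, M whose value is that monomial.) -/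
open Finset MvPolynomial

/-- Expressions built from the symbol `u`, unary symbols `d j` and the binary symbol `M`. -/
inductive PExpr : Type
  | u : PExpr
  | d : ℕ → PExpr → PExpr
  | M : PExpr → PExpr → PExpr

/-- The degree of an expression: the number of instances of `u` in it. -/
def pdeg : PExpr → ℕ
  | .u => 1
  | .d _ a => pdeg a
  | .M a b => pdeg a + pdeg b

/-- The size of an expression: the total number of symbols `u`, `d`, `M` in it. -/
def psize : PExpr → ℕ
  | .u => 1
  | .d _ a => psize a + 1
  | .M a b => psize a + psize b + 1

/-- An expression is valid when every `d j` occurring in it satisfies `1 ≤ j ≤ deg` of its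
argument. -/
def PValid : PExpr → Prop
  | .u => True
  | .d j a => 1 ≤ j ∧ j ≤ pdeg a ∧ PValid a
  | .M a b => PValid a ∧ PValid b

/-- Increase the `j`-th entry (0-based) of a list of naturals by one. -/
def bump : List ℕ → ℕ → List ℕ
  | [], _ => []
  | x :: xs, 0 => (x + 1) :: xs
  | x :: xs, j + 1 => x :: bump xs j

/-- The index tuple `ι(a)` of an expression: `ι(u) = (0)`, `ι(d j a)` is `ι(a)` with the `j`-th
entry increased by one, and `ι(M a b)` is the concatenation of `ι(a)` and `ι(b)`. -/
def idx : PExpr → List ℕ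
  | .u => [0]
  | .d j a => bump (idx a) (j - 1)
  | .M a b => idx a ++ idx b

/-- The value of an expression: the monomial `X (ι(a)₁) ⋯ X (ι(a)_d)` in `MvPolynomial ℕ ℚ`. -/
noncomputable def expandE (a : PExpr) : MvPolynomial ℕ ℚ :=
  ((idx a).map (fun i => (X i : MvPolynomial ℕ ℚ))).prod

theorem bump_length (l : List ℕ) (j : ℕ) : (bump l j).length = l.length := by
  induction l generalizing j with
  | nil => simp [bump]
  | cons x xs ih => cases j <;> simp [bump, ih]

theorem idx_length (a : PExpr) : (idx a).length = pdeg a := by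
  induction a with
  | u => rfl
  | d j a ih => simp [idx, pdeg, bump_length, ih]
  | M a b iha ihb => simp [idx, pdeg, iha, ihb]

theorem psize_pos (a : PExpr) : 1 ≤ psize a := by
  cases a <;> simp [psize]

theorem deriv_list (D : Derivation ℚ (MvPolynomial ℕ ℚ) (MvPolynomial ℕ ℚ))
    (hD : ∀ i, D (X i) = X (i + 1)) (l : List ℕ) :
    D ((l.map (fun i => (X i : MvPolynomial ℕ ℚ))).prod) =
      ∑ j ∈ range l.length,
        ((bump l j).map (fun i => (X i : MvPolynomial ℕ ℚ))).prod := by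
  induction l with
  | nil => simp
  | cons x xs ih =>
    rw [List.length_cons, Finset.sum_range_succ']
    simp only [List.map_cons, List.prod_cons, Derivation.leibniz, ih, hD, bump, smul_eq_mul,
      Finset.mul_sum]
    ring

theorem deriv_expandE (D : Derivation ℚ (MvPolynomial ℕ ℚ) (MvPolynomial ℕ ℚ))
    (hD : ∀ i, D (X i) = X (i + 1)) (a : PExpr) :
    D (expandE a) = ∑ j ∈ Icc 1 (pdeg a), expandE (.d j a) := by
  unfold expandE
  rw [deriv_list D hD, idx_length, Finset.range_eq_Ico, ← Finset.Ico_add_one_right_eq_Icc,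
    ← Finset.sum_Ico_add' _ 0 (pdeg a) 1]
  simp [idx]

theorem exists_finset_sum (D : Derivation ℚ (MvPolynomial ℕ ℚ) (MvPolynomial ℕ ℚ))
    (hD : ∀ i, D (X i) = X (i + 1))
    (f : ℕ → MvPolynomial ℕ ℚ)
    (hf1 : f 1 = X 0)
    (hf : ∀ m, 1 ≤ m → f (m + 1) = D (f m) + ∑ s ∈ Icc 1 (m - 1), f s * f (m - s))
    (n : ℕ) (hn : 1 ≤ n) :
    ∃ S : Finset PExpr, (∀ a, a ∈ S ↔ PValid a ∧ psize a = n) ∧ f n = ∑ a ∈ S, expandE a := by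
  classical
  induction n using Nat.strong_induction_on with
  | _ n ih =>
  obtain rfl | ⟨m, hm, rfl⟩ : n = 1 ∨ ∃ m, 1 ≤ m ∧ n = m + 1 := by
    rcases Nat.lt_or_ge 1 n with h | h
    · exact Or.inr ⟨n - 1, by omega, by omega⟩
    · exact Or.inl (by omega)
  · refine ⟨{.u}, ?_, ?_⟩
    · intro a
      cases a with
      | u => simp [PValid, psize]
      | d j a => have := psize_pos a; simp [psize]; omega
      | M a b => have := psize_pos a; simp [psize]; omega
    · simp [hf1, expandE, idx]
  · have ih' : ∀ k, (1 ≤ k ∧ k ≤ m) → ∃ S : Finset PExpr,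
        (∀ a, a ∈ S ↔ PValid a ∧ psize a = k) ∧ f k = ∑ a ∈ S, expandE a :=
      fun k hk => ih k (by omega) hk.1
    choose! S hS hfS using ih'
    let A : Finset PExpr :=
      ((S m).sigma (fun a => Icc 1 (pdeg a))).image (fun p => PExpr.d p.2 p.1)
    let B : Finset PExpr :=
      ((Icc 1 (m - 1)).sigma (fun s => S s ×ˢ S (m - s))).image (fun p => PExpr.M p.2.1 p.2.2)
    have hAB : Disjoint A B := by
      rw [Finset.disjoint_left]
      intro x hx hy
      simp only [A, B, Finset.mem_image] at hx hy
      obtain ⟨p, -, rfl⟩ := hx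
      obtain ⟨q, -, h⟩ := hy
      cases h
    refine ⟨A ∪ B, ?_, ?_⟩
    · intro a
      simp only [A, B, Finset.mem_union, Finset.mem_image, Finset.mem_sigma, Finset.mem_product,
        Finset.mem_Icc, Sigma.exists, Prod.exists]
      constructor
      · rintro (⟨a, j, ⟨ha, hj⟩, rfl⟩ | ⟨s, a, b, ⟨hs, ha, hb⟩, rfl⟩)
        · rw [hS m ⟨hm, le_rfl⟩] at ha
          exact ⟨⟨hj.1, hj.2, ha.1⟩, by simp [psize, ha.2]⟩
        · rw [hS s (by omega)] at ha
          rw [hS (m - s) (by omega)] at hb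
          exact ⟨⟨ha.1, hb.1⟩, by simp only [psize]; omega⟩
      · rintro ⟨hv, hs⟩
        cases a with
        | u => simp only [psize] at hs; omega
        | d j a =>
          simp only [psize] at hs
          exact Or.inl ⟨a, j, ⟨(hS m ⟨hm, le_rfl⟩ a).2 ⟨hv.2.2, by omega⟩, hv.1, hv.2.1⟩, rfl⟩
        | M a b =>
          simp only [psize] at hs
          have h1 := psize_pos a
          have h2 := psize_pos b
          exact Or.inr ⟨psize a, a, b, ⟨⟨h1, by omega⟩,
            (hS _ (by omega) a).2 ⟨hv.1, rfl⟩, (hS _ (by omega) b).2 ⟨hv.2, by omega⟩⟩, rfl⟩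
    · rw [Finset.sum_union hAB, hf m hm]
      congr 1
      · rw [Finset.sum_image, Finset.sum_sigma, hfS m ⟨hm, le_rfl⟩, map_sum]
        · exact Finset.sum_congr rfl fun a _ => deriv_expandE D hD a
        · rintro ⟨a, j⟩ - ⟨b, k⟩ - h
          cases h
          rfl
      · rw [Finset.sum_image, Finset.sum_sigma]
        · refine Finset.sum_congr rfl fun s hs => ?_
          rw [Finset.mem_Icc] at hs
          rw [hfS s (by omega), hfS (m - s) (by omega), Finset.sum_mul_sum, Finset.sum_product]
          simp [expandE, idx]
        · rintro ⟨s, a, b⟩ h1 ⟨t, a', b'⟩ h2 h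
          simp only [Finset.coe_sigma, Set.mem_sigma_iff, Finset.mem_coe, Finset.mem_product,
            Finset.mem_Icc] at h1 h2
          simp only [PExpr.M.injEq] at h
          obtain ⟨rfl, rfl⟩ := h
          have e1 := ((hS s (by omega) a).1 h1.2.1).2
          have e2 := ((hS t (by omega) a).1 h2.2.1).2
          have : s = t := by omega
          subst this
          rfl

/-- The KdV generating polynomials `f 1 = X 0`,
`f (n+1) = D (f n) + Σ_{s=1}^{n−1} (f s)·(f (n−s))` satisfy
`f n = Σ_{a ∈ Φₙ} expand a`, the sum over the (finite) set `Φₙ` of all valid expressions of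
size `n`. -/
theorem kdv_polynomial_eq_sum_over_expressions
    (D : Derivation ℚ (MvPolynomial ℕ ℚ) (MvPolynomial ℕ ℚ))
    (hD : ∀ i, D (X i) = X (i + 1))
    (f : ℕ → MvPolynomial ℕ ℚ)
    (hf1 : f 1 = X 0)
    (hf : ∀ m, 1 ≤ m → f (m + 1) = D (f m) + ∑ s ∈ Icc 1 (m - 1), f s * f (m - s))
    (n : ℕ) (hn : 1 ≤ n) :
    f n = ∑ᶠ a ∈ {a : PExpr | PValid a ∧ psize a = n}, expandE a := by
  obtain ⟨S, hS, h⟩ := exists_finset_sum D hD f hf1 hf n hn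
  have e : {a : PExpr | PValid a ∧ psize a = n} = (S : Set PExpr) := by
    ext a
    simp [hS]
  rw [h, e, finsum_mem_coe_finset]
end

section
/- For every natural number n, the number of expressions of size n+1 (built from the symbols u, d_j, M) equals the number of non-overlapping set partitions of [n] = {1,…,n}. (Equivalently: the operations M and d_j on non-overlapping partitions generate every non-overlapping partition in a unique way, so that Φ_{n+1} is in bijection with Π*_n.) -/
open Finset

attribute [local instance] Classical.propDecidable

/-- Two finsets `α`, `β` of `Fin n` overlap if `min α < min β < max α < max β`. -/
def Overlap {n : ℕ} (α β : Finset (Fin n)) : Prop :=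
  ∃ (hα : α.Nonempty) (hβ : β.Nonempty),
    α.min' hα < β.min' hβ ∧ β.min' hβ < α.max' hα ∧ α.max' hα < β.max' hβ

/-- A set partition is non-overlapping (a NOP) if no two of its blocks overlap. -/
def IsNOP {n : ℕ} (π : Finpartition (univ : Finset (Fin n))) : Prop :=
  ∀ α ∈ π.parts, ∀ β ∈ π.parts, ¬ Overlap α β


namespace NopCount
open PowerSeries

/-! ### The continued fraction -/

/-- Coefficients of the tails of the continued fraction. -/
noncomputable def rc : ℕ → ℕ → Polynomial ℤ
  | _, 0 => 0
  | m, n + 1 => (if n = 0 then 1 else 0) + ((m : Polynomial ℤ) + 1) * rc m n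
      + Polynomial.X * ∑ i : Fin (n + 1), rc m i * rc (m + 1) (n - i)
  termination_by _ n => n
  decreasing_by all_goals omega

noncomputable def R (m : ℕ) : PowerSeries (Polynomial ℤ) := PowerSeries.mk (rc m)

/-- the variable `t` -/
noncomputable def tv : PowerSeries (Polynomial ℤ) := PowerSeries.C Polynomial.X

lemma sum_fin_antidiag {A : Type*} [CommRing A] (f g : ℕ → A) (n : ℕ) :
    ∑ i : Fin (n + 1), f i * g (n - i) = ∑ p ∈ antidiagonal n, f p.1 * g p.2 := by
  rw [Finset.Nat.sum_antidiagonal_eq_sum_range_succ (fun i j => f i * g j)]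
  rw [Finset.sum_range]

lemma R_eq (m : ℕ) : R m = X * (1 + ((m : PowerSeries (Polynomial ℤ)) + 1) * R m + tv * (R m * R (m + 1))) := by
  ext1 n
  cases n with
  | zero => simp [R, rc]
  | succ n =>
    have h : ((m : PowerSeries (Polynomial ℤ)) + 1) = PowerSeries.C ((m : Polynomial ℤ) + 1) := by simp
    rw [coeff_succ_X_mul, h, tv, map_add, map_add, coeff_C_mul, coeff_C_mul, coeff_one, coeff_mul]
    simp only [R, coeff_mk]
    rw [rc, sum_fin_antidiag (rc m) (rc (m+1))]

/-- derivative in `t` -/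
noncomputable def dT (f : PowerSeries (Polynomial ℤ)) : PowerSeries (Polynomial ℤ) :=
  PowerSeries.mk fun n => Polynomial.derivative (coeff n f)

lemma dT_add (f g) : dT (f + g) = dT f + dT g := by ext1 n; simp [dT]
lemma dT_mul (f g) : dT (f * g) = dT f * g + f * dT g := by
  ext1 n
  simp [dT, coeff_mul, Polynomial.derivative_mul, sum_add_distrib]
lemma dT_X : dT X = 0 := by
  ext1 n; simp only [dT, coeff_mk, coeff_X]; split_ifs <;> simp
lemma dT_one : dT 1 = 0 := by
  ext1 n; simp only [dT, coeff_mk, coeff_one]; split_ifs <;> simp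
lemma dT_nat (m : ℕ) : dT (m : PowerSeries (Polynomial ℤ)) = 0 := by
  induction m with
  | zero => ext1 n; simp [dT]
  | succ m ih => push_cast; rw [dT_add, ih, dT_one, add_zero]
lemma dT_tv : dT tv = 1 := by
  ext1 n; simp only [dT, tv, coeff_mk, coeff_C, coeff_one]; split_ifs <;> simp

noncomputable def DD (m : ℕ) : PowerSeries (Polynomial ℤ) := dT (R m) - R m * R (m + 1) + R m ^ 2

lemma DD_eq (m : ℕ) : DD m = R m ^ 2 * tv * DD (m + 1) := by
  have h1 := R_eq m
  have h2 := R_eq (m + 1)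
  have h3 : dT (R m) = X * (((m : PowerSeries (Polynomial ℤ)) + 1) * dT (R m)
      + R m * R (m + 1) + tv * (dT (R m) * R (m + 1) + R m * dT (R (m + 1)))) := by
    conv_lhs => rw [R_eq m]
    simp only [dT_add, dT_mul, dT_X, dT_one, dT_nat, dT_tv]
    ring
  push_cast at h2
  have hX : (X : PowerSeries (Polynomial ℤ)) ≠ 0 := X_ne_zero
  apply mul_left_cancel₀ hX
  unfold DD
  generalize dT (R m) = u' at *
  generalize dT (R (m+1)) = v' at *
  generalize R (m+1+1) = w at *
  generalize R (m+1) = v at *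
  generalize R m = u at *
  have h4 : X * u' = X * (u^2 * (v + tv * v')) := by
    linear_combination u * h3 - u' * h1
  linear_combination h4 + u * (v * h1 - u * h2)

lemma X_dvd_R (m : ℕ) : X ∣ R m := by rw [R_eq m]; exact dvd_mul_right _ _

lemma DD_zero (m : ℕ) : DD m = 0 := by
  have key : ∀ k m, X ^ k ∣ DD m := by
    intro k
    induction k with
    | zero => intro m; simp
    | succ k ih =>
      intro m
      rw [DD_eq m, pow_succ']
      refine mul_dvd_mul ?_ (ih _)
      exact Dvd.dvd.mul_right (dvd_pow (X_dvd_R m) two_ne_zero) _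
  ext1 n
  have := X_pow_dvd_iff.1 (key (n + 1) m) n (by omega)
  simpa using this

/-- The Riccati equation. -/
lemma riccati : tv * R 0 = X * (tv + tv * dT (tv * R 0) + (tv * R 0) ^ 2) := by
  have h1 := R_eq 0
  have h2 := DD_zero 0
  unfold DD at h2
  rw [dT_mul, dT_tv]
  push_cast at h1
  simp only [zero_add] at *
  linear_combination tv * h1 - X * tv^2 * h2

/-! ### Motzkin path counts -/

/-- weighted Motzkin paths of length `n` from height `h` to height `0` -/
def mp : ℕ → ℕ → ℕ
  | 0, h => if h = 0 then 1 else 0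
  | n + 1, 0 => mp n 0 + mp n 1
  | n + 1, h + 1 => mp n h + (h + 2) * mp n (h + 1) + mp n (h + 2)

noncomputable def rho (m : ℕ) : PowerSeries ℤ := PowerSeries.map (Polynomial.evalRingHom 1) (R m)

lemma rho_eq (m : ℕ) : rho m = X * (1 + ((m : PowerSeries ℤ) + 1) * rho m + (rho m * rho (m + 1))) := by
  have := congrArg (PowerSeries.map (Polynomial.evalRingHom (1:ℤ))) (R_eq m)
  simpa [tv, rho] using this

noncomputable def Q (h : ℕ) : PowerSeries ℤ := ∏ i ∈ range h, rho i

lemma Q_eq (h : ℕ) : Q (h + 1) = X * (Q h + ((h + 1 : ℤ)) • Q (h + 1) + Q (h + 2)) := by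
  have := rho_eq h
  simp only [Q, prod_range_succ, zsmul_eq_mul]
  push_cast
  linear_combination (∏ i ∈ range h, rho i) * this

lemma coeff_Q (n h : ℕ) : coeff (n + 1) (Q (h + 1)) = (mp n h : ℤ) := by
  induction n generalizing h with
  | zero =>
    rw [Q_eq, coeff_succ_X_mul]
    have h0 : ∀ h, coeff 0 (Q (h + 1)) = 0 := by
      intro h; rw [Q_eq]; simp
    simp only [map_add, map_zsmul, h0]
    cases h with
    | zero => simp [Q, mp]
    | succ h => simp only [h0]; simp [mp]
  | succ n ih =>
    rw [Q_eq, coeff_succ_X_mul]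
    simp only [map_add, map_zsmul, ih]
    cases h with
    | zero => simp [Q, mp, coeff_one]
    | succ h => simp only [ih, mp]; push_cast; simp only [smul_eq_mul]; ring

lemma rc_eval (n : ℕ) : (rc 0 (n + 1)).eval 1 = (mp n 0 : ℤ) := by
  rw [← coeff_Q]
  simp [Q, rho, R]

/-! ### Expressions -/

noncomputable def Ex : ℕ → Finset PExpr
  | 0 => ∅
  | n + 1 => (if n = 0 then {PExpr.u} else ∅) ∪
      ((Ex n).biUnion (fun a => (Icc 1 (pdeg a)).image (fun j => PExpr.d j a)) ∪
      (univ : Finset (Fin (n + 1))).biUnion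
        (fun i => (Ex i ×ˢ Ex (n - i)).image (fun p => PExpr.M p.1 p.2)))
  termination_by n => n
  decreasing_by all_goals omega

lemma mem_Ex (a : PExpr) : ∀ n, a ∈ Ex n ↔ PValid a ∧ psize a = n := by
  induction a with
  | u => intro n; cases n with
    | zero => simp [Ex, psize]
    | succ n =>
      rw [Ex]; by_cases h : n = 0 <;> simp [h, PValid, psize]
      try omega
  | d j a ih => intro n; cases n with
    | zero => simp [Ex, psize]
    | succ n =>
      rw [Ex]; by_cases h : n = 0 <;> simp [h, PValid, psize, ih] <;> tauto
  | M a b iha ihb => intro n; cases n with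
    | zero => simp [Ex, psize]
    | succ n =>
      have key : (∃ i : Fin (n + 1), (PValid a ∧ psize a = i) ∧ PValid b ∧ psize b = n - i) ↔
        (PValid a ∧ PValid b) ∧ psize a + psize b + 1 = n + 1 := by
        constructor
        · rintro ⟨i, ⟨h1, h2⟩, h3, h4⟩
          exact ⟨⟨h1, h3⟩, by have := i.2; omega⟩
        · rintro ⟨⟨h1, h2⟩, h3⟩
          exact ⟨⟨psize a, by omega⟩, ⟨h1, rfl⟩, h2, by simp; omega⟩
      rw [Ex]; by_cases h : n = 0
      · simp only [PValid, psize, ← key]; simp [h, iha, ihb]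
      · simp only [PValid, psize, ← key]; simp [h, iha, ihb]

noncomputable def Ep (n : ℕ) : Polynomial ℤ := ∑ a ∈ Ex n, Polynomial.X ^ pdeg a

lemma Ep_succ (n : ℕ) : Ep (n + 1) = (if n = 0 then Polynomial.X else 0) +
    Polynomial.X * Polynomial.derivative (Ep n) + ∑ p ∈ antidiagonal n, Ep p.1 * Ep p.2 := by
  rw [← sum_fin_antidiag Ep Ep]
  conv_lhs => rw [Ep, Ex]
  rw [sum_union, sum_union, sum_biUnion, sum_biUnion, add_assoc]
  · congr 1
    · split_ifs <;> simp [pdeg]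
    congr 1
    · rw [Ep, Polynomial.derivative_sum, mul_sum]
      apply sum_congr rfl
      intro a ha
      rw [sum_image (by intro x _ y _ h; simpa using h)]
      simp only [pdeg, sum_const, Nat.card_Icc, Polynomial.derivative_X_pow]
      cases pdeg a with
      | zero => simp
      | succ k => simp; ring
    · apply sum_congr rfl
      intro i _
      rw [sum_image (by rintro ⟨x, x'⟩ _ ⟨y, y'⟩ _ h; simpa using h), sum_product, Ep, Ep, sum_mul_sum]
      simp [pdeg, pow_add]
  · intro i _ j _ hij
    rw [Function.onFun, Finset.disjoint_left]
    rintro c hc hc'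
    simp only [mem_image, mem_product, mem_Ex] at hc hc'
    obtain ⟨⟨x, x'⟩, h, rfl⟩ := hc
    obtain ⟨⟨y, y'⟩, h', h''⟩ := hc'
    simp only [PExpr.M.injEq] at h''
    apply hij
    ext
    rw [← h.1.2, ← h'.1.2, h''.1]
  · intro i _ j _ hij
    rw [Function.onFun, Finset.disjoint_left]
    rintro c hc hc'
    simp only [mem_image] at hc hc'
    obtain ⟨x, h, rfl⟩ := hc
    obtain ⟨y, h', h''⟩ := hc'
    simp only [PExpr.d.injEq] at h''
    exact hij h''.2.symm
  · rw [Finset.disjoint_left]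
    intro c hc hc'
    simp only [mem_biUnion, mem_image] at hc hc'
    obtain ⟨_, _, _, _, rfl⟩ := hc
    obtain ⟨_, _, _, _, h⟩ := hc'
    simp at h
  · rw [Finset.disjoint_left]
    intro c hc hc'
    have : c = PExpr.u := by split_ifs at hc <;> simp_all
    subst this
    simp at hc'

lemma Ep_eq (n : ℕ) : Ep n = coeff n (tv * R 0) := by
  induction n using Nat.strong_induction_on with
  | _ n ih =>
    cases n with
    | zero => simp [Ep, Ex, R, tv, rc]
    | succ n =>
      rw [riccati, coeff_succ_X_mul, Ep_succ, ih n (by omega), pow_two, map_add, map_add, coeff_mul n (tv * R 0)]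
      congr 1
      · congr 1
        · rw [tv, coeff_C]
        · conv_rhs => rw [tv, coeff_C_mul, dT, coeff_mk]
          rfl
      · apply sum_congr rfl
        intro p hp
        rw [HasAntidiagonal.mem_antidiagonal] at hp
        rw [ih p.1 (by omega), ih p.2 (by omega)]

lemma card_Ex (n : ℕ) : (Ex (n + 1)).card = mp n 0 := by
  have h := congrArg (Polynomial.eval 1) (Ep_eq (n + 1))
  rw [tv, coeff_C_mul, R, coeff_mk] at h
  simp only [Polynomial.eval_mul, Polynomial.eval_X, one_mul, rc_eval, Ep, Polynomial.eval_finsetSum,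
    Polynomial.eval_pow, one_pow, sum_const, nsmul_eq_mul, mul_one] at h
  exact_mod_cast h

lemma card_expr (n : ℕ) : Nat.card {a : PExpr // PValid a ∧ psize a = n + 1} = mp n 0 := by
  rw [← card_Ex]; exact Nat.subtype_card _ (fun a => mem_Ex a _)

/-! ### Partial non-overlapping partitions -/

/-- block `b` contains an element after `i`, or is still open -/
def Op (n : ℕ) (f : ℕ → ℕ) (O : Finset ℕ) (i b : ℕ) : Prop :=
  b ∈ O ∨ ∃ j, i < j ∧ j < n ∧ f j = b

structure Inv (n : ℕ) (f : ℕ → ℕ) (O : Finset ℕ) : Prop where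
  le : ∀ i, f i ≤ i
  idem : ∀ i, f (f i) = f i
  triv : ∀ i, n ≤ i → f i = i
  root : ∀ o ∈ O, o < n ∧ f o = o
  nov : ∀ i, i < n → ∀ b, f i < b → b < i → Op n f O i b → Op n f O i (f i)

abbrev St := (ℕ → ℕ) × Finset ℕ

noncomputable def sa (n : ℕ) (s : St) (a : ℕ) : St := (Function.update s.1 n a, s.2)
noncomputable def sb (n : ℕ) (s : St) (a : ℕ) : St := (Function.update s.1 n a, s.2.erase a)

noncomputable def nxt (n : ℕ) (s : St) : Finset St :=
  ({s} ∪ {(s.1, insert n s.2)}) ∪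
    (s.2.image (sa n s) ∪ (s.2.filter (fun a => ∀ b ∈ s.2, b ≤ a)).image (sb n s))

noncomputable def prv (n : ℕ) (s : St) : St :=
  (Function.update s.1 n n, (insert (s.1 n) s.2).erase n)

lemma Op_prv {n : ℕ} {f : ℕ → ℕ} {O : Finset ℕ} {i b : ℕ} (hi : i < n) (hb : b < n) :
    Op (n + 1) f O i b ↔ Op n (prv n (f, O)).1 (prv n (f, O)).2 i b := by
  simp only [Op, prv, mem_erase, mem_insert]
  constructor
  · rintro (h | ⟨j, h1, h2, h3⟩)
    · left; exact ⟨by omega, Or.inr h⟩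
    · by_cases hj : j = n
      · subst hj; left; exact ⟨by omega, Or.inl h3.symm⟩
      · right; exact ⟨j, h1, by omega, by rw [Function.update_of_ne hj]; exact h3⟩
  · rintro (⟨h, h' | h'⟩ | ⟨j, h1, h2, h3⟩)
    · right; exact ⟨n, hi, by omega, h'.symm⟩
    · left; exact h'
    · right; refine ⟨j, h1, by omega, ?_⟩
      rwa [Function.update_of_ne (by omega)] at h3

lemma Inv_prv {n : ℕ} {s : St} (h : Inv (n + 1) s.1 s.2) : Inv n (prv n s).1 (prv n s).2 := by
  obtain ⟨f, O⟩ := s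
  have hf : ∀ i, i ≠ n → (prv n (f, O)).1 i = f i := fun i hi => by
    simp only [prv]; rw [Function.update_of_ne hi]
  have hn : (prv n (f, O)).1 n = n := by simp [prv]
  have hle := h.le
  have hid := h.idem
  have htr := h.triv
  have hr := h.root
  simp only at hle hid htr hr
  refine ⟨?_, ?_, ?_, ?_, ?_⟩
  · intro i
    by_cases hi : i = n
    · subst hi; rw [hn]
    · rw [hf i hi]; exact hle i
  · intro i
    by_cases hi : i = n
    · subst hi; rw [hn, hn]
    · rw [hf i hi]
      by_cases h2 : f i = n
      · rw [h2, hn]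
      · rw [hf _ h2]; exact hid i
  · intro i hi
    by_cases hi' : i = n
    · subst hi'; rw [hn]
    · rw [hf i hi']; exact htr i (by omega)
  · intro o ho
    simp only [prv, mem_erase, mem_insert] at ho
    rw [hf o ho.1]
    rcases ho with ⟨h1, h2 | h2⟩
    · have := hle n
      exact ⟨by omega, by rw [h2]; exact hid n⟩
    · have := hr o h2
      exact ⟨by omega, this.2⟩
  · intro i hi b h1 h2 h3
    rw [hf i (by omega)] at h1 ⊢
    rw [← Op_prv hi (by omega)] at h3 ⊢
    exact h.nov i (by omega) b h1 h2 h3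

lemma mem_nxt {n : ℕ} {s s' : St} : s' ∈ nxt n s ↔ s' = s ∨ s' = (s.1, insert n s.2) ∨
    (∃ a ∈ s.2, s' = sa n s a) ∨ (∃ a ∈ s.2, (∀ b ∈ s.2, b ≤ a) ∧ s' = sb n s a) := by
  simp only [nxt, mem_union, mem_singleton, mem_image, mem_filter]
  constructor
  · rintro ((h | h) | ⟨a, h1, h2⟩ | ⟨a, h1, h2⟩)
    · exact Or.inl h
    · exact Or.inr (Or.inl h)
    · exact Or.inr (Or.inr (Or.inl ⟨a, h1, h2.symm⟩))
    · exact Or.inr (Or.inr (Or.inr ⟨a, h1.1, h1.2, h2.symm⟩))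
  · rintro (h | h | ⟨a, h1, h2⟩ | ⟨a, h1, h2, h3⟩)
    · exact Or.inl (Or.inl h)
    · exact Or.inl (Or.inr h)
    · exact Or.inr (Or.inl ⟨a, h1, h2.symm⟩)
    · exact Or.inr (Or.inr ⟨a, ⟨h1, h2⟩, h3.symm⟩)

lemma mem_nxt_prv {n : ℕ} {s : St} (h : Inv (n + 1) s.1 s.2) : s ∈ nxt n (prv n s) := by
  obtain ⟨f, O⟩ := s
  rw [mem_nxt]
  have hup : f = Function.update (Function.update f n n) n (f n) := by simp
  by_cases h1 : f n = n
  · have hu : Function.update f n n = f := by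
      conv_rhs => rw [← Function.update_eq_self n f, h1]
    by_cases h2 : n ∈ O
    · right; left
      simp only [prv, h1, hu]
      rw [insert_eq_of_mem h2, insert_erase h2]
    · left
      simp only [prv, h1, hu]
      rw [erase_insert h2]
  · have hlt : f n < n := lt_of_le_of_ne (h.le n) h1
    have hnO : n ∉ O := fun hh => h1 (h.root n hh).2
    have hO' : (prv n (f, O)).2 = insert (f n) O := by
      simp only [prv]
      rw [erase_eq_of_notMem]
      simp only [mem_insert, not_or]; exact ⟨by omega, hnO⟩
    right; right
    by_cases h2 : f n ∈ O
    · left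
      refine ⟨f n, by rw [hO']; simp, ?_⟩
      rw [sa, hO', insert_eq_of_mem h2, prv, ← hup]
    · right
      refine ⟨f n, by rw [hO']; simp, ?_, ?_⟩
      · rw [hO']
        intro b hb
        rw [mem_insert] at hb
        rcases hb with rfl | hb
        · exact le_rfl
        · by_contra hc
          have hbn : b < n := by
            have := (h.root b hb).1
            have : b ≠ n := fun e => hnO (e ▸ hb)
            omega
          rcases h.nov n (by omega) b (by simp only; omega) hbn (Or.inl hb) with h3 | ⟨j, h3, h4, _⟩
          · exact h2 h3
          · omega
      · rw [sb, hO', erase_insert h2, prv, ← hup]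

lemma prv_of_mem_nxt {n : ℕ} {s s' : St} (h : Inv n s.1 s.2) (hs : s' ∈ nxt n s) :
    prv n s' = s := by
  obtain ⟨f, O⟩ := s
  have h1 : f n = n := h.triv n le_rfl
  have hu : Function.update f n n = f := by
    conv_rhs => rw [← Function.update_eq_self n f, h1]
  have hnO : n ∉ O := fun hh => lt_irrefl _ (h.root n hh).1
  rw [mem_nxt] at hs
  rcases hs with rfl | rfl | ⟨a, ha, rfl⟩ | ⟨a, ha, _, rfl⟩
  · simp only [prv, h1, hu]; rw [erase_insert hnO]
  · simp only [prv, h1, hu]; rw [insert_eq_of_mem (mem_insert_self _ _), erase_insert hnO]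
  · simp only [prv, sa, Function.update_self, Function.update_idem, hu] at *
    rw [insert_eq_of_mem ha, erase_eq_of_notMem hnO]
  · simp only [prv, sb, Function.update_self, Function.update_idem, hu] at *
    rw [insert_erase ha, erase_eq_of_notMem hnO]

lemma Inv_of_mem_nxt {n : ℕ} {s s' : St} (h : Inv n s.1 s.2) (hs : s' ∈ nxt n s) :
    Inv (n + 1) s'.1 s'.2 := by
  have hp := prv_of_mem_nxt h hs
  have hnO : n ∉ s.2 := fun hh => lt_irrefl _ (h.root n hh).1
  have hfn : s.1 n = n := h.triv n le_rfl
  have hloc : (s'.1 n = n ∨ s'.1 n ∈ s.2) ∧ (∀ o ∈ s'.2, o = n ∧ s'.1 n = n ∨ o ∈ s.2) ∧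
      (∀ b ∈ s'.2, s'.1 n < b → b < n → s'.1 n ∈ s'.2) := by
    rw [mem_nxt] at hs
    rcases hs with rfl | rfl | ⟨a, ha, rfl⟩ | ⟨a, ha, hm, rfl⟩
    · exact ⟨Or.inl hfn, fun o ho => Or.inr ho, fun b _ _ _ => by omega⟩
    · refine ⟨Or.inl hfn, fun o ho => ?_, fun b _ _ _ => ?_⟩
      · rw [mem_insert] at ho
        exact ho.imp (fun e => ⟨e, hfn⟩) id
      · simp only at *; omega
    · simp only [sa, Function.update_self]
      exact ⟨Or.inr ha, fun o ho => Or.inr ho, fun _ _ _ _ => ha⟩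
    · simp only [sb, Function.update_self]
      refine ⟨Or.inr ha, fun o ho => Or.inr (mem_of_mem_erase ho), fun b hb h1 _ => ?_⟩
      have := hm b (mem_of_mem_erase hb)
      omega
  obtain ⟨f, O⟩ := s
  obtain ⟨g, P⟩ := s'
  simp only at hloc hnO hfn h
  have hg : ∀ i, i ≠ n → g i = f i := by
    intro i hi
    have := congrFun (congrArg Prod.fst hp) i
    simp only [prv] at this
    rwa [Function.update_of_ne hi] at this
  obtain ⟨l1, l2, l3⟩ := hloc
  have hle := h.le
  have hid := h.idem
  have htr := h.triv
  have hr := h.root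
  refine ⟨?_, ?_, ?_, ?_, ?_⟩ <;> simp only
  · intro i
    by_cases hi : i = n
    · subst hi
      rcases l1 with l | l
      · omega
      · have := hr _ l; omega
    · rw [hg i hi]; exact hle i
  · intro i
    by_cases hi : i = n
    · subst hi
      rcases l1 with l | l
      · rw [l, l]
      · have := hr _ l
        rw [hg (g i) (by omega)]; exact this.2
    · rw [hg i hi]
      have h1 : f i ≠ n := by
        intro e
        have h2 := hle i
        have h3 := htr i (by omega)
        omega
      rw [hg _ h1]; exact hid i
  · intro i hi
    rw [hg i (by omega)]; exact htr i (by omega)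
  · intro o ho
    rcases l2 o ho with ⟨rfl, h2⟩ | h2
    · exact ⟨by omega, h2⟩
    · have := hr o h2
      exact ⟨by omega, by rw [hg o (by omega)]; exact this.2⟩
  · intro i hi b h1 h2 h3
    by_cases hin : i = n
    · subst hin
      rcases h3 with h3 | ⟨j, h3, h4, _⟩
      · exact Or.inl (l3 b h3 h1 h2)
      · omega
    · have hi' : i < n := by omega
      rw [Op_prv hi' (by omega), hp] at h3 ⊢
      rw [hg i hin] at h1 ⊢
      exact h.nov i hi' b h1 h2 h3

noncomputable def CC : ℕ → Finset St
  | 0 => {(id, ∅)}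
  | n + 1 => (CC n).biUnion (nxt n)

lemma mem_CC (n : ℕ) : ∀ s : St, s ∈ CC n ↔ Inv n s.1 s.2 := by
  induction n with
  | zero =>
    rintro ⟨f, O⟩
    simp only [CC, mem_singleton, Prod.mk.injEq]
    constructor
    · rintro ⟨rfl, rfl⟩
      exact ⟨fun i => le_rfl, fun i => rfl, fun i _ => rfl, by simp, by simp⟩
    · intro h
      refine ⟨funext fun i => h.triv i (by omega), ?_⟩
      rw [eq_empty_iff_forall_notMem]
      intro o ho
      exact absurd (h.root o ho).1 (by omega)
  | succ n ih =>
    intro s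
    simp only [CC, mem_biUnion]
    constructor
    · rintro ⟨s', h1, h2⟩
      exact Inv_of_mem_nxt ((ih s').1 h1) h2
    · intro h
      exact ⟨prv n s, (ih _).2 (Inv_prv h), mem_nxt_prv h⟩

lemma sum_nxt {n : ℕ} {s : St} (h : Inv n s.1 s.2) (m : ℕ) :
    ∑ s' ∈ nxt n s, mp m s'.2.card = mp (m + 1) s.2.card := by
  obtain ⟨f, O⟩ := s
  have hnO : n ∉ O := fun hh => lt_irrefl _ (h.root n hh).1
  have hfn : f n = n := h.triv n le_rfl
  have hne : ∀ a ∈ O, a ≠ n := fun a ha e => hnO (e ▸ ha)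
  have inj1 : Set.InjOn (sa n (f, O)) O := by
    intro a _ b _ hab
    have := congrFun (congrArg Prod.fst hab) n
    simpa [sa] using this
  have inj2 : Set.InjOn (sb n (f, O)) (O.filter (fun a => ∀ b ∈ O, b ≤ a)) := by
    intro a _ b _ hab
    have := congrFun (congrArg Prod.fst hab) n
    simpa [sb] using this
  rw [nxt, sum_union, sum_union, sum_union, sum_image inj1, sum_image inj2]
  · simp only [sum_singleton, sa, sb, sum_const, smul_eq_mul]
    rw [card_insert_of_notMem hnO]
    have h3 : ∑ x ∈ O with ∀ b ∈ O, b ≤ x, mp m (O.erase x).card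
        = ∑ x ∈ O with ∀ b ∈ O, b ≤ x, mp m (O.card - 1) := by
      apply sum_congr rfl
      intro x hx
      rw [card_erase_of_mem (mem_filter.1 hx).1]
    rw [h3, sum_const, smul_eq_mul]
    rcases O.eq_empty_or_nonempty with rfl | hO
    · simp [mp]
    · have : (O.filter (fun a => ∀ b ∈ O, b ≤ a)) = {O.max' hO} := by
        ext x
        simp only [mem_filter, mem_singleton]
        constructor
        · rintro ⟨h1, h2⟩
          exact le_antisymm (le_max' _ _ h1) (h2 _ (max'_mem _ _))
        · rintro rfl
          exact ⟨max'_mem _ _, fun b hb => le_max' _ _ hb⟩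
      rw [this, card_singleton]
      obtain ⟨k, hk⟩ : ∃ k, O.card = k + 1 := ⟨O.card - 1, by have := hO.card_pos; omega⟩
      rw [hk, mp]
      simp only [Nat.add_sub_cancel]
      ring
  · rw [Finset.disjoint_left]
    intro c hc hc'
    simp only [mem_image, mem_filter] at hc hc'
    obtain ⟨a, ha, rfl⟩ := hc
    obtain ⟨b, hb, e⟩ := hc'
    have := congrArg (fun s : St => s.2.card) e
    simp only [sa, sb] at this
    have h1 := card_erase_lt_of_mem hb.1
    omega
  · rw [Finset.disjoint_left]
    intro c hc hc'
    simp only [mem_singleton] at hc hc'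
    subst hc
    have := congrArg Prod.snd hc'
    simp only at this
    exact hnO (this ▸ mem_insert_self _ _)
  · rw [Finset.disjoint_left]
    intro c hc hc'
    have h1 : c.1 n = n := by
      simp only [mem_union, mem_singleton] at hc
      rcases hc with rfl | rfl <;> exact hfn
    simp only [mem_union, mem_image, mem_filter] at hc'
    rcases hc' with ⟨a, ha, rfl⟩ | ⟨a, ha, rfl⟩
    · simp only [sa, Function.update_self] at h1; exact hne a ha h1
    · simp only [sb, Function.update_self] at h1; exact hne a ha.1 h1

lemma sum_CC (n m : ℕ) : ∑ s ∈ CC n, mp m s.2.card = mp (n + m) 0 := by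
  induction n generalizing m with
  | zero => simp [CC]
  | succ n ih =>
    rw [CC, sum_biUnion]
    · rw [sum_congr rfl (fun s hs => sum_nxt ((mem_CC n s).1 hs) m), ih]
      congr 1; omega
    · intro s hs s' hs' hne
      rw [Function.onFun, Finset.disjoint_left]
      intro c hc hc'
      apply hne
      rw [← prv_of_mem_nxt ((mem_CC n s).1 hs) hc, ← prv_of_mem_nxt ((mem_CC n s').1 hs') hc']

lemma card_closed (n : ℕ) : ((CC n).filter (fun s => s.2 = ∅)).card = mp n 0 := by
  have := sum_CC n 0
  rw [add_zero] at this
  rw [← this, card_filter]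
  apply sum_congr rfl
  intro s _
  simp [mp]

/-! ### Finpartitions -/

noncomputable def mn {n : ℕ} (π : Finpartition (univ : Finset (Fin n))) (i : Fin n) : Fin n :=
  (π.part i).min' ⟨i, π.mem_part (mem_univ i)⟩

noncomputable def rt {n : ℕ} (π : Finpartition (univ : Finset (Fin n))) (i : ℕ) : ℕ :=
  if h : i < n then mn π ⟨i, h⟩ else i

section
variable {n : ℕ} (π : Finpartition (univ : Finset (Fin n)))

lemma rt_fin (i : Fin n) : rt π i = mn π i := by simp [rt]

lemma mn_mem (i : Fin n) : mn π i ∈ π.part i := min'_mem _ _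

lemma mn_le {i j : Fin n} (h : j ∈ π.part i) : mn π i ≤ j := min'_le _ _ h

lemma part_eq {i j : Fin n} : j ∈ π.part i ↔ π.part j = π.part i :=
  π.mem_part_iff_part_eq_part (mem_univ _) (mem_univ _)

lemma mn_congr {i j : Fin n} (h : π.part j = π.part i) : mn π j = mn π i := by
  simp only [mn, h]

lemma mem_part_iff_mn {i j : Fin n} : j ∈ π.part i ↔ mn π j = mn π i := by
  constructor
  · intro h; exact mn_congr π ((part_eq π).1 h)
  · intro h
    rw [part_eq, ← (part_eq π).1 (mn_mem π j), h]
    exact (part_eq π).1 (mn_mem π i)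

lemma mn_idem (i : Fin n) : mn π (mn π i) = mn π i := (mem_part_iff_mn π).1 (mn_mem π i)

lemma rt_inv (hπ : IsNOP π) : Inv n (rt π) ∅ := by
  refine ⟨?_, ?_, ?_, by simp, ?_⟩
  · intro i
    unfold rt
    split_ifs with h
    · exact mn_le π (π.mem_part (mem_univ _))
    · exact le_rfl
  · intro i
    by_cases h : i < n
    · have := rt_fin π ⟨i, h⟩
      simp only at this
      rw [this, rt_fin, mn_idem]
    · have : rt π i = i := by simp [rt, h]
      rw [this, this]
  · intro i h; simp [rt, not_lt.2 h]
  · intro i hi b h1 h2 h3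
    rcases h3 with h3 | ⟨j, h3, h4, h5⟩
    · simp at h3
    right
    have ei := rt_fin π ⟨i, hi⟩
    have ej := rt_fin π ⟨j, h4⟩
    simp only at ei ej
    have hno := hπ _ (π.part_mem.2 (mem_univ ⟨i, hi⟩)) _ (π.part_mem.2 (mem_univ ⟨j, h4⟩))
    have ne1 : (π.part ⟨i, hi⟩).Nonempty := ⟨_, π.mem_part (mem_univ _)⟩
    have ne2 : (π.part ⟨j, h4⟩).Nonempty := ⟨_, π.mem_part (mem_univ _)⟩
    have a1 : (⟨i, hi⟩ : Fin n) ≤ (π.part ⟨i, hi⟩).max' ne1 := le_max' _ _ (π.mem_part (mem_univ _))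
    have a2 : (⟨j, h4⟩ : Fin n) ≤ (π.part ⟨j, h4⟩).max' ne2 := le_max' _ _ (π.mem_part (mem_univ _))
    have b1 : mn π ⟨i, hi⟩ < mn π ⟨j, h4⟩ := by rw [Fin.lt_def]; omega
    have b2 : mn π ⟨j, h4⟩ < (π.part ⟨i, hi⟩).max' ne1 := by
      refine lt_of_lt_of_le ?_ a1; rw [Fin.lt_def]; simp only; omega
    have b3 : ¬ (π.part ⟨i, hi⟩).max' ne1 < (π.part ⟨j, h4⟩).max' ne2 :=
      fun hh => hno ⟨ne1, ne2, b1, b2, hh⟩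
    have b4 := a2.trans (not_lt.1 b3)
    refine ⟨((π.part ⟨i, hi⟩).max' ne1 : Fin n), ?_, Fin.is_lt _, ?_⟩
    · rw [Fin.le_def] at b4; simp only at b4; omega
    · rw [rt_fin, ei, (mem_part_iff_mn π).1 (max'_mem _ ne1)]

lemma nop_of_inv (h : Inv n (rt π) ∅) : IsNOP π := by
  rintro α hα β hβ ⟨ne1, ne2, h1, h2, h3⟩
  have ha := max'_mem α ne1
  have hb := max'_mem β ne2
  have pa : π.part (α.max' ne1) = α := π.part_eq_of_mem hα ha
  have pb : π.part (β.max' ne2) = β := π.part_eq_of_mem hβ hb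
  have ma : mn π (α.max' ne1) = α.min' ne1 := by simp only [mn, pa]
  have mb : mn π (β.max' ne2) = β.min' ne2 := by simp only [mn, pb]
  have := h.nov (α.max' ne1 : Fin n) (Fin.is_lt _) (β.min' ne2 : Fin n) (by rw [rt_fin, ma]; exact h1) h2
    (Or.inr ⟨(β.max' ne2 : Fin n), h3, Fin.is_lt _, by rw [rt_fin, mb]⟩)
  rcases this with h4 | ⟨k, h4, h5, h6⟩
  · simp at h4
  · have e : rt π k = mn π ⟨k, h5⟩ := rt_fin π ⟨k, h5⟩
    rw [e, rt_fin] at h6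
    have h7 : (⟨k, h5⟩ : Fin n) ∈ π.part (α.max' ne1) := (mem_part_iff_mn π).2 (Fin.ext h6)
    rw [pa] at h7
    have := le_max' _ _ h7
    rw [Fin.le_def] at this
    simp only at this
    omega
end

lemma rt_inj {n : ℕ} {π σ : Finpartition (univ : Finset (Fin n))} (h : rt π = rt σ) : π = σ := by
  have hm : ∀ i, mn π i = mn σ i := fun i => by
    have := congrFun h i
    rw [rt_fin, rt_fin] at this
    exact Fin.ext this
  have hp : ∀ i, π.part i = σ.part i := by
    intro i; ext j
    rw [mem_part_iff_mn, mem_part_iff_mn, hm, hm]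
  have key : ∀ (π σ : Finpartition (univ : Finset (Fin n))), (∀ i, π.part i = σ.part i) →
      ∀ p ∈ π.parts, p ∈ σ.parts := by
    intro π σ hp p h
    obtain ⟨x, hx⟩ := π.nonempty_of_mem_parts h
    rw [← π.part_eq_of_mem h hx, hp]
    exact σ.part_mem.2 (mem_univ _)
  apply Finpartition.ext
  ext p
  exact ⟨key π σ hp p, key σ π (fun i => (hp i).symm) p⟩

lemma rt_surj {n : ℕ} {f : ℕ → ℕ} (h : Inv n f ∅) :
    ∃ π : Finpartition (univ : Finset (Fin n)), rt π = f := by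
  let S : Setoid (Fin n) := Setoid.comap (fun i : Fin n => f i) ⊥
  have hS : ∀ i j, S i j ↔ f i = f j := fun i j => Iff.rfl
  refine ⟨Finpartition.ofSetoid S, funext fun i => ?_⟩
  by_cases hi : i < n
  · have e : rt (Finpartition.ofSetoid S) i = mn (Finpartition.ofSetoid S) ⟨i, hi⟩ :=
      rt_fin (Finpartition.ofSetoid S) ⟨i, hi⟩
    rw [e]
    have hlt : f i < n := lt_of_le_of_lt (h.le i) hi
    apply le_antisymm
    · have : (⟨f i, hlt⟩ : Fin n) ∈ (Finpartition.ofSetoid S).part ⟨i, hi⟩ := by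
        rw [Finpartition.mem_part_ofSetoid_iff_rel, hS]
        exact (h.idem i).symm
      exact mn_le _ this
    · have := mn_mem (Finpartition.ofSetoid S) ⟨i, hi⟩
      rw [Finpartition.mem_part_ofSetoid_iff_rel, hS] at this
      simp only at this
      rw [this]
      exact h.le _
  · simp only [rt, hi, dif_neg, not_false_eq_true]
    exact (h.triv i (by omega)).symm

lemma card_nop (n : ℕ) :
    (univ.filter (fun π : Finpartition (univ : Finset (Fin n)) => IsNOP π)).card = mp n 0 := by
  rw [← card_closed]
  apply card_bij (fun π _ => ((rt π, ∅) : St))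
  · intro π hπ
    rw [mem_filter] at hπ ⊢
    exact ⟨(mem_CC n _).2 (rt_inv π hπ.2), rfl⟩
  · intro π _ σ _ e
    exact rt_inj (congrArg Prod.fst e)
  · rintro ⟨f, O⟩ hs
    rw [mem_filter, mem_CC] at hs
    obtain ⟨h, h'⟩ := hs
    simp only at h h'
    subst h'
    obtain ⟨π, rfl⟩ := rt_surj h
    exact ⟨π, by rw [mem_filter]; exact ⟨mem_univ _, nop_of_inv π h⟩, rfl⟩

end NopCount

/-- The number of valid expressions of size `n+1` equals the number of non-overlapping set
partitions of `[n]`. -/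
theorem card_expressions_eq_card_nops (n : ℕ) :
    Nat.card {a : PExpr // PValid a ∧ psize a = n + 1} =
      (univ.filter (fun π : Finpartition (univ : Finset (Fin n)) => IsNOP π)).card := by
  rw [NopCount.card_expr, NopCount.card_nop]
end
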